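/- arXiv:1603.07883 — 2 statements merged into one kernel-verified Lean document; each statement's English description precedes it below -/
import Mathlib

section
/- For integers 1 ≤ j ≤ k−1 there exists a constant c = c(k,j) > 0 such that the following holds. Let 0 ≤ p1 = p1(n), p2 = p2(n) ≤ 1 and let H ∼ H_k(n,p1,p2). If p1·p2 ≤ 1/(c·n^{2k−2j−1}·log n), then with high probability H does not j-percolate. -/
open Finset Filter

/-- Two clusters `C`, `C'` of `j`-sets can be merged: they are joined by an edge of `E1` (red)
and an edge of `E2` (blue). -/
def Mergeable {V : Type*} [DecidableEq V] (E1 E2 C C' : Finset (Finset V)) : Prop :=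
  (∃ J1 ∈ C, ∃ J1' ∈ C', ∃ e1 ∈ E1, J1 ∪ J1' ⊆ e1) ∧
  (∃ J2 ∈ C, ∃ J2' ∈ C', ∃ e2 ∈ E2, J2 ∪ J2' ⊆ e2)

/-- One elementary merging step of the jigsaw percolation process on the double hypergraph
`(V, E1, E2)`: two distinct mergeable clusters of the current partition `P` are replaced by
their union.  Iterating such pairwise merges as long as possible yields exactly the final
partition of the (deterministic) jigsaw percolation process. -/
def MergeStep {V : Type*} [DecidableEq V] (E1 E2 : Finset (Finset V))
    (P P' : Finset (Finset (Finset V))) : Prop :=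
  ∃ C ∈ P, ∃ C' ∈ P, C ≠ C' ∧ Mergeable E1 E2 C C' ∧
    P' = insert (C ∪ C') ((P.erase C).erase C')

/-- The family `J0` of `j`-sets percolates on the double hypergraph `(V, E1, E2)`:
starting from the partition of `J0` into singletons, a sequence of merges reaches the
partition with a single class. -/
def PercolatesOn {V : Type*} [DecidableEq V] (J0 E1 E2 : Finset (Finset V)) : Prop :=
  Relation.ReflTransGen (MergeStep E1 E2)
    (J0.image fun J => ({J} : Finset (Finset V))) {J0}

/-- The double `k`-graph `(V, E1, E2)` `j`-percolates: the family of all `j`-element subsets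
of `V` percolates on `(V, E1, E2)`. -/
def JPercolates {V : Type*} [DecidableEq V] [Fintype V] (j : ℕ)
    (E1 E2 : Finset (Finset V)) : Prop :=
  PercolatesOn ((Finset.univ : Finset V).powersetCard j) E1 E2
open scoped Classical in
/-- The probability that a pair of independent binomial random subsets of the ground set `K`
(where each element of `K` is included in the first subset with probability `p1` and in the
second with probability `p2`, independently) satisfies the event `A`. -/
noncomputable def probDouble {α : Type*} [DecidableEq α] (K : Finset α) (p1 p2 : ℝ)
    (A : Finset α → Finset α → Prop) : ℝ :=
  ∑ E1 ∈ K.powerset, ∑ E2 ∈ K.powerset,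
    if A E1 E2 then
      p1 ^ E1.card * (1 - p1) ^ (K.card - E1.card) *
        p2 ^ E2.card * (1 - p2) ^ (K.card - E2.card)
    else 0

/-- The probability that the random double `k`-graph `H ~ H_k(n, p1, p2)` on vertex set
`Fin n` (each `k`-set is a red edge with probability `p1` and a blue edge with probability
`p2`, independently over colours and `k`-sets) satisfies the event `A`. -/
noncomputable def probHk (n k : ℕ) (p1 p2 : ℝ)
    (A : Finset (Finset (Fin n)) → Finset (Finset (Fin n)) → Prop) : ℝ :=
  probDouble ((Finset.univ : Finset (Fin n)).powersetCard k) p1 p2 A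

/-- `S` is connected to `A` (cut formulation) with respect to the neighbourhood function `N`. -/
def CutConn {α : Type*} [DecidableEq α] (N : α → Finset α) (A S : Finset α) : Prop :=
  ∀ T, T ⊆ S → T.Nonempty → ∃ t ∈ T, ∃ u ∈ A ∪ (S \ T), t ∈ N u

open scoped Classical in
lemma cutConn_count {α : Type*} [DecidableEq α] [Fintype α] (N : α → Finset α) (D : ℕ)
    (hN : ∀ a, (N a).card ≤ D) (q : ℕ) : ∀ (A : Finset α) (r : ℕ), A.card + r ≤ q →
    (((univ : Finset α).powersetCard r).filter (fun S => CutConn N A S)).card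
      ≤ (D * q).choose r := by
  induction q with
  | zero =>
    intro A r h
    have hr : r = 0 := by omega
    subst hr
    simp only [mul_zero, Nat.choose_self]
    exact (card_filter_le _ _).trans (by simp)
  | succ q ih =>
    intro A r h
    rcases A.eq_empty_or_nonempty with rfl | ⟨a, ha⟩
    · rcases Nat.eq_zero_or_pos r with rfl | hr
      · simp only [Nat.choose_zero_right]
        exact (card_filter_le _ _).trans (by simp)
      · rw [Finset.card_eq_zero.2]
        · exact Nat.zero_le _
        · refine Finset.filter_eq_empty_iff.2 ?_
          intro S hS hc
          have hS := (mem_powersetCard.1 hS).2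
          obtain ⟨t, _, u, hu, _⟩ := hc S subset_rfl (card_pos.1 (by omega))
          simp at hu
    · have hmaps : ∀ S ∈ ((univ : Finset α).powersetCard r).filter (fun S => CutConn N A S),
          S ∩ N a ∈ (N a).powerset.filter (fun T => T.card ≤ r) := by
        intro S hS
        rw [mem_filter, mem_powersetCard] at hS
        rw [mem_filter, mem_powerset]
        exact ⟨inter_subset_right, (card_le_card inter_subset_left).trans hS.1.2.le⟩
      rw [card_eq_sum_card_fiberwise hmaps]
      have hfib : ∀ T ∈ (N a).powerset.filter (fun T => T.card ≤ r),
          ((((univ : Finset α).powersetCard r).filter (fun S => CutConn N A S)).filter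
            (fun S => S ∩ N a = T)).card ≤ (D * q).choose (r - T.card) := by
        intro T hT
        rw [mem_filter, mem_powerset] at hT
        refine le_trans ?_ (ih (A.erase a ∪ T) (r - T.card) ?_)
        · refine card_le_card_of_injOn (fun S => S \ N a) ?_ ?_
          · intro S hS
            simp only [coe_filter, mem_filter, mem_powersetCard, Set.mem_ofPred_eq] at hS ⊢
            obtain ⟨⟨⟨_, hSc⟩, hcon⟩, hST⟩ := hS
            refine ⟨⟨subset_univ _, ?_⟩, ?_⟩
            · have := card_sdiff_add_card_inter S (N a)
              rw [hST] at this
              omega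
            · intro T' hT' hne
              obtain ⟨t, ht, u, hu, htu⟩ := hcon T' (hT'.trans sdiff_subset) hne
              refine ⟨t, ht, u, ?_, htu⟩
              have hta : t ∉ N a := (Finset.mem_sdiff.1 (hT' ht)).2
              have hua : u ≠ a := by rintro rfl; exact hta htu
              rw [← hST]
              simp only [mem_union, Finset.mem_sdiff, mem_erase, mem_inter] at hu ⊢
              tauto
          · intro S hS S' hS' hEq
            simp only [coe_filter, mem_filter, Set.mem_ofPred_eq] at hS hS'
            have h1 := hS.2
            have h2 := hS'.2
            simp only at hEq
            rw [← sdiff_union_inter S (N a), ← sdiff_union_inter S' (N a), hEq, h1, h2]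
        · have h1 := card_union_le (A.erase a) T
          have h2 := card_erase_add_one ha
          omega
      refine (sum_le_sum hfib).trans ?_
      have h3 : ∑ T ∈ (N a).powerset.filter (fun T => T.card ≤ r), (D * q).choose (r - T.card)
          ≤ ((N a).card + D * q).choose r := by
        rw [Nat.add_choose_eq, Finset.Nat.sum_antidiagonal_eq_sum_range_succ_mk,
          ← sum_fiberwise_of_maps_to (s := (N a).powerset.filter (fun T => T.card ≤ r))
            (t := range r.succ) (g := fun T => T.card)]
        · refine sum_le_sum ?_
          intro t ht
          rw [sum_congr rfl (g := fun _ => (D * q).choose (r - t))]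
          · rw [sum_const, smul_eq_mul]
            refine Nat.mul_le_mul_right _ ?_
            rw [← card_powersetCard]
            refine card_le_card ?_
            intro T hT
            simp only [mem_filter, mem_powerset, mem_powersetCard] at hT ⊢
            tauto
          · intro T hT
            rw [(mem_filter.1 hT).2]
        · intro T hT
          simp only [mem_filter, mem_range] at hT ⊢
          omega
      refine h3.trans (Nat.choose_le_choose r ?_)
      have := hN a
      rw [Nat.mul_succ]
      omega

/-- Neighbourhoods: `k`-sets meeting `u` in at least `j` elements. -/
def nbh {V : Type*} [DecidableEq V] [Fintype V] (j k : ℕ) (u : Finset V) : Finset (Finset V) :=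
  univ.filter (fun t => u.card ≤ k ∧ t.card = k ∧ j ≤ (u ∩ t).card)

lemma card_supersets {n : ℕ} (hn : 1 ≤ n) (k i : ℕ) (U : Finset (Fin n)) (hU : i ≤ U.card) :
    ((univ : Finset (Finset (Fin n))).filter (fun t => t.card = k ∧ U ⊆ t)).card
      ≤ n ^ (k - i) := by
  calc _ ≤ ((univ : Finset (Fin n)).powersetCard (k - U.card)).card := by
        refine card_le_card_of_injOn (fun t => t \ U) ?_ ?_
        · intro t ht
          simp only [coe_filter, mem_univ, true_and, Set.mem_ofPred_eq] at ht
          simp only [mem_coe, mem_powersetCard]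
          refine ⟨subset_univ _, ?_⟩
          rw [card_sdiff_of_subset ht.2, ht.1]
        · intro t ht t' ht' h
          simp only [coe_filter, mem_univ, true_and, Set.mem_ofPred_eq] at ht ht'
          simp only at h
          rw [← sdiff_union_of_subset ht.2, h, sdiff_union_of_subset ht'.2]
    _ ≤ n ^ (k - U.card) := by
        rw [card_powersetCard, card_univ, Fintype.card_fin]
        exact Nat.choose_le_pow _ _
    _ ≤ n ^ (k - i) := Nat.pow_le_pow_right hn (by omega)

lemma card_nbh {n : ℕ} (hn : 1 ≤ n) (j k : ℕ) (u : Finset (Fin n)) :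
    (nbh j k u).card ≤ k.choose j * n ^ (k - j) := by
  by_cases hu : u.card ≤ k
  · have hsub : nbh j k u ⊆ (u.powersetCard j).biUnion
        (fun U => (univ : Finset (Finset (Fin n))).filter (fun t => t.card = k ∧ U ⊆ t)) := by
      intro t ht
      simp only [nbh, mem_filter, mem_univ, true_and] at ht
      obtain ⟨U, hU, hUc⟩ := exists_subset_card_eq ht.2.2
      simp only [mem_biUnion, mem_powersetCard, mem_filter, mem_univ, true_and]
      exact ⟨U, ⟨hU.trans inter_subset_left, hUc⟩, ht.2.1, hU.trans inter_subset_right⟩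
    refine (card_le_card hsub).trans ((card_biUnion_le_card_mul _ _ (n ^ (k - j)) ?_).trans ?_)
    · intro U hU
      exact card_supersets hn k j U (mem_powersetCard.1 hU).2.ge
    · rw [card_powersetCard]
      exact Nat.mul_le_mul_right _ (Nat.choose_le_choose j hu)
  · rw [nbh, filter_eq_empty_iff.2]
    · simp
    · intro t _ h
      exact hu h.1

/-- The `j`-sets covered by `R`. -/
def shad {V : Type*} [DecidableEq V] (j : ℕ) (R : Finset (Finset V)) : Finset (Finset V) :=
  R.biUnion (fun e => e.powersetCard j)

lemma card_shad {V : Type*} [DecidableEq V] (j k : ℕ) (R : Finset (Finset V))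
    (hR : ∀ e ∈ R, e.card = k) : (shad j R).card ≤ R.card * k.choose j := by
  refine card_biUnion_le_card_mul _ _ _ ?_
  intro e he
  rw [card_powersetCard, hR e he]

/-- `k`-sets containing two distinct `j`-sets covered by `R`. -/
def adm {V : Type*} [DecidableEq V] [Fintype V] (j k : ℕ) (R : Finset (Finset V)) :
    Finset (Finset V) :=
  univ.filter (fun t => t.card = k ∧ ∃ J ∈ shad j R, ∃ J' ∈ shad j R, J ≠ J' ∧ J ∪ J' ⊆ t)

lemma card_adm {n : ℕ} (hn : 1 ≤ n) (j k : ℕ) (R : Finset (Finset (Fin n)))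
    (hR : ∀ e ∈ R, e.card = k) :
    (adm j k R).card ≤ (R.card * k.choose j) ^ 2 * n ^ (k - (j + 1)) := by
  have hsub : adm j k R ⊆ ((shad j R ×ˢ shad j R).filter (fun x => x.1 ≠ x.2)).biUnion
      (fun x => (univ : Finset (Finset (Fin n))).filter
        (fun t => t.card = k ∧ x.1 ∪ x.2 ⊆ t)) := by
    intro t ht
    simp only [adm, mem_filter, mem_univ, true_and] at ht
    obtain ⟨hk, J, hJ, J', hJ', hne, hs⟩ := ht
    simp only [mem_biUnion, mem_filter, mem_univ, true_and, mem_product]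
    exact ⟨(J, J'), ⟨⟨hJ, hJ'⟩, hne⟩, hk, hs⟩
  refine (card_le_card hsub).trans
    ((card_biUnion_le_card_mul _ _ (n ^ (k - (j + 1))) ?_).trans ?_)
  · rintro ⟨J, J'⟩ hx
    simp only [mem_filter, mem_product, shad, mem_biUnion, mem_powersetCard] at hx
    obtain ⟨⟨⟨_, _, _, hJ⟩, ⟨_, _, _, hJ'⟩⟩, hne⟩ := hx
    refine card_supersets hn k (j + 1) _ ?_
    by_contra hlt
    replace hlt : ¬ (j + 1 ≤ (J ∪ J').card) := hlt
    have h1 : (J ∪ J').card ≤ j := by omega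
    have e1 : J = J ∪ J' := eq_of_subset_of_card_le subset_union_left (by omega)
    have e2 : J' = J ∪ J' := eq_of_subset_of_card_le subset_union_right (by omega)
    exact hne (e1.trans e2.symm)
  · refine Nat.mul_le_mul_right _ ((card_filter_le _ _).trans ?_)
    rw [card_product, ← sq]
    exact Nat.pow_le_pow_left (card_shad j k R hR) 2

/-- Witness that the edges `R ⊆ E` connect the cluster `C`. -/
def Wit {V : Type*} [DecidableEq V] [Fintype V] (j k : ℕ) (E C R : Finset (Finset V)) : Prop :=
  R ⊆ E ∧ R.card + 1 ≤ C.card ∧ (∀ J ∈ C, CutConn (nbh j k) {J} R) ∧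
    (∀ J ∈ C, C = {J} ∨ ∃ e ∈ R, J ⊆ e) ∧
    (∀ e ∈ R, ∃ J ∈ C, ∃ J' ∈ C, J ≠ J' ∧ J ∪ J' ⊆ e)

lemma wit_singleton {V : Type*} [DecidableEq V] [Fintype V] (j k : ℕ) (E : Finset (Finset V))
    (J : Finset V) : Wit j k E {J} ∅ := by
  refine ⟨empty_subset _, by simp, ?_, ?_, by simp⟩
  · intro J' _ T hT hne
    exact absurd (subset_empty.1 hT) hne.ne_empty
  · intro J' h
    left
    rw [mem_singleton.1 h]

lemma conn_merge {V : Type*} [DecidableEq V] [Fintype V] {j k : ℕ} (hjk : j ≤ k)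
    {E C C' R R' : Finset (Finset V)} (hE : ∀ t ∈ E, t.card = k)
    (hC : ∀ J ∈ C, J.card = j) (hC' : ∀ J ∈ C', J.card = j)
    (h : Wit j k E C R) (h' : Wit j k E C' R') {e J1 J1' : Finset V} (he : e ∈ E)
    (h1 : J1 ∈ C) (h1' : J1' ∈ C') (hs : J1 ∪ J1' ⊆ e) :
    ∀ J ∈ C, CutConn (nbh j k) {J} (insert e (R ∪ R')) := by
  intro J hJ T hT hne
  obtain ⟨hRE, _, hcon, hcov, _⟩ := h
  obtain ⟨hRE', _, hcon', _, _⟩ := h'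
  have hs1 : J1 ⊆ e := subset_union_left.trans hs
  have hs1' : J1' ⊆ e := subset_union_right.trans hs
  by_cases hTR : (T ∩ R).Nonempty
  · obtain ⟨t, ht, u, hu, htu⟩ := hcon J hJ (T ∩ R) inter_subset_right hTR
    refine ⟨t, (mem_inter.1 ht).1, u, ?_, htu⟩
    simp only [mem_union, Finset.mem_sdiff, mem_inter, mem_singleton, mem_insert] at hu ⊢
    tauto
  · have hdis : ∀ f ∈ R, f ∉ T := by
      intro f hf hfT
      exact hTR ⟨f, mem_inter.2 ⟨hfT, hf⟩⟩
    by_cases heT : e ∈ T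
    · refine ⟨e, heT, ?_⟩
      rcases hcov J1 h1 with hsing | ⟨f, hf, hJf⟩
      · refine ⟨J, by simp, ?_⟩
        have hJ1 : J = J1 := by
          rw [hsing] at hJ
          exact mem_singleton.1 hJ
        rw [hJ1]
        simp only [nbh, mem_filter, mem_univ, true_and]
        rw [inter_eq_left.2 hs1, hC J1 h1]
        exact ⟨hjk, hE e he, le_rfl⟩
      · refine ⟨f, ?_, ?_⟩
        · simp [hf, hdis f hf]
        · simp only [nbh, mem_filter, mem_univ, true_and]
          refine ⟨(hE f (hRE hf)).le, hE e he, ?_⟩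
          rw [← hC J1 h1]
          exact card_le_card (subset_inter hJf hs1)
    · have hTR' : T ⊆ R' := by
        intro t ht
        have := hT ht
        simp only [mem_insert, mem_union] at this
        rcases this with rfl | h | h
        · exact absurd ht heT
        · exact absurd ht (hdis t h)
        · exact h
      obtain ⟨t, ht, u, hu, htu⟩ := hcon' J1' h1' T hTR' hne
      refine ⟨t, ht, ?_⟩
      simp only [mem_union, mem_singleton, Finset.mem_sdiff] at hu
      rcases hu with rfl | hu
      · refine ⟨e, by simp [heT], ?_⟩
        simp only [nbh, mem_filter, mem_univ, true_and] at htu ⊢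
        exact ⟨(hE e he).le, htu.2.1, htu.2.2.trans (card_le_card (inter_subset_inter_right hs1'))⟩
      · exact ⟨u, by simp [hu.1, hu.2], htu⟩

lemma wit_merge {V : Type*} [DecidableEq V] [Fintype V] {j k : ℕ} (hjk : j ≤ k)
    {E C C' R R' : Finset (Finset V)} (hE : ∀ t ∈ E, t.card = k)
    (hC : ∀ J ∈ C, J.card = j) (hC' : ∀ J ∈ C', J.card = j) (hd : Disjoint C C')
    (h : Wit j k E C R) (h' : Wit j k E C' R') {e J1 J1' : Finset V} (he : e ∈ E)
    (h1 : J1 ∈ C) (h1' : J1' ∈ C') (hs : J1 ∪ J1' ⊆ e) :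
    Wit j k E (C ∪ C') (insert e (R ∪ R')) := by
  have hc1 := conn_merge hjk hE hC hC' h h' he h1 h1' hs
  have hc2 := conn_merge hjk hE hC' hC h' h he h1' h1 (by rwa [union_comm])
  obtain ⟨hRE, hcard, hcon, hcov, htwo⟩ := h
  obtain ⟨hRE', hcard', hcon', hcov', htwo'⟩ := h'
  have hs1 : J1 ⊆ e := subset_union_left.trans hs
  have hs1' : J1' ⊆ e := subset_union_right.trans hs
  refine ⟨?_, ?_, ?_, ?_, ?_⟩
  · exact insert_subset he (union_subset hRE hRE')
  · have a1 := card_insert_le e (R ∪ R')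
    have a2 := card_union_le R R'
    rw [card_union_of_disjoint hd]
    omega
  · intro J hJ
    rcases mem_union.1 hJ with hJ | hJ
    · exact hc1 J hJ
    · rw [union_comm]; exact hc2 J hJ
  · intro J hJ
    right
    rcases mem_union.1 hJ with hJ | hJ
    · rcases hcov J hJ with hx | ⟨f, hf, hJf⟩
      · rw [hx, mem_singleton] at h1
        exact ⟨e, by simp, h1 ▸ hs1⟩
      · exact ⟨f, by simp [hf], hJf⟩
    · rcases hcov' J hJ with hx | ⟨f, hf, hJf⟩
      · rw [hx, mem_singleton] at h1'
        exact ⟨e, by simp, h1' ▸ hs1'⟩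
      · exact ⟨f, by simp [hf], hJf⟩
  · intro f hf
    simp only [mem_insert, mem_union] at hf
    rcases hf with rfl | hf | hf
    · refine ⟨J1, mem_union_left _ h1, J1', mem_union_right _ h1', ?_, hs⟩
      rintro rfl
      exact disjoint_left.1 hd h1 h1'
    · obtain ⟨J, hJ, J', hJ', hx⟩ := htwo f hf
      exact ⟨J, mem_union_left _ hJ, J', mem_union_left _ hJ', hx⟩
    · obtain ⟨J, hJ, J', hJ', hx⟩ := htwo' f hf
      exact ⟨J, mem_union_right _ hJ, J', mem_union_right _ hJ', hx⟩

lemma exists_mid_cluster {V : Type*} [DecidableEq V] [Fintype V] {j k : ℕ} (hjk : j ≤ k)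
    {E1 E2 : Finset (Finset V)} (hE1 : ∀ t ∈ E1, t.card = k) (hE2 : ∀ t ∈ E2, t.card = k)
    (hP : JPercolates j E1 E2) {L : ℕ} (hL : 2 ≤ L)
    (hbig : L ≤ ((univ : Finset V).powersetCard j).card) :
    ∃ C R B : Finset (Finset V), L ≤ C.card ∧ C.card < 2 * L ∧ (∀ J ∈ C, J.card = j) ∧
      Wit j k E1 C R ∧ Wit j k E2 C B := by
  by_contra hno
  have key : ∀ P, Relation.ReflTransGen (MergeStep E1 E2)
      (((univ : Finset V).powersetCard j).image fun J => ({J} : Finset (Finset V))) P →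
      (∀ C ∈ P, ∀ C' ∈ P, C ≠ C' → Disjoint C C') ∧
      (∀ C ∈ P, C.card < L ∧ (∀ J ∈ C, J.card = j) ∧ ∃ R B, Wit j k E1 C R ∧ Wit j k E2 C B) := by
    intro P hreach
    induction hreach with
    | refl =>
      constructor
      · intro C hC C' hC' hne
        obtain ⟨J, _, rfl⟩ := mem_image.1 hC
        obtain ⟨J', _, rfl⟩ := mem_image.1 hC'
        rw [disjoint_singleton]
        rintro rfl
        exact hne rfl
      · intro C hC
        obtain ⟨J, hJ, rfl⟩ := mem_image.1 hC
        refine ⟨by rw [card_singleton]; omega, ?_, ∅, ∅, wit_singleton _ _ _ _, wit_singleton _ _ _ _⟩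
        intro J' hJ'
        rw [mem_singleton.1 hJ']
        exact (mem_powersetCard.1 hJ).2
    | tail _ hstep ih =>
      obtain ⟨hdis, hall⟩ := ih
      obtain ⟨C, hC, C', hC', hne, ⟨⟨J1, h1, J1', h1', e1, he1, hs1⟩,
        ⟨J2, h2, J2', h2', e2, he2, hs2⟩⟩, rfl⟩ := hstep
      obtain ⟨hl, hj1, R, B, hR, hB⟩ := hall C hC
      obtain ⟨hl', hj1', R', B', hR', hB'⟩ := hall C' hC'
      have hd := hdis C hC C' hC' hne
      constructor
      · intro D hD D' hD' hDne
        simp only [mem_insert, mem_erase] at hD hD'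
        rcases hD with rfl | ⟨hD1, hD2, hD3⟩ <;> rcases hD' with rfl | ⟨hD1', hD2', hD3'⟩
        · exact absurd rfl hDne
        · rw [disjoint_union_left]
          exact ⟨hdis _ hC _ hD3' (Ne.symm hD2'), hdis _ hC' _ hD3' (Ne.symm hD1')⟩
        · rw [disjoint_union_right]
          exact ⟨hdis _ hD3 _ hC hD2, hdis _ hD3 _ hC' hD1⟩
        · exact hdis _ hD3 _ hD3' hDne
      · intro D hD
        simp only [mem_insert, mem_erase] at hD
        rcases hD with rfl | ⟨hD1, hD2, hD3⟩
        · have w1 := wit_merge hjk hE1 hj1 hj1' hd hR hR' he1 h1 h1' hs1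
          have w2 := wit_merge hjk hE2 hj1 hj1' hd hB hB' he2 h2 h2' hs2
          have hcj : ∀ J ∈ C ∪ C', J.card = j := by
            intro J hJ
            rcases mem_union.1 hJ with hJ | hJ
            · exact hj1 J hJ
            · exact hj1' J hJ
          refine ⟨?_, hcj, _, _, w1, w2⟩
          by_contra hge
          refine hno ⟨_, _, _, by omega, ?_, hcj, w1, w2⟩
          have := card_union_le C C'
          omega
        · exact hall D hD3
  have := ((key _ hP).2 _ (mem_singleton_self _)).1
  omega

/-- The bad event with `r` edges of each colour. -/
def BadEv {V : Type*} [DecidableEq V] [Fintype V] (j k r : ℕ) (E1 E2 : Finset (Finset V)) : Prop :=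
  ∃ J ∈ (univ : Finset V).powersetCard j, ∃ R, R.card = r ∧ CutConn (nbh j k) {J} R ∧
    (∀ e ∈ R, e.card = k) ∧ R ⊆ E1 ∧ ∃ B, B ⊆ adm j k R ∧ B.card = r ∧ B ⊆ E2

lemma wit_lower {V : Type*} [DecidableEq V] [Fintype V] {j k : ℕ}
    {E C R : Finset (Finset V)} (hE : ∀ t ∈ E, t.card = k) (hC : ∀ J ∈ C, J.card = j)
    (h2 : 2 ≤ C.card) (h : Wit j k E C R) : C ⊆ shad j R ∧ C.card ≤ R.card * k.choose j := by
  have hs : C ⊆ shad j R := by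
    intro J hJ
    rcases h.2.2.2.1 J hJ with hx | ⟨e, he, hJe⟩
    · rw [hx, card_singleton] at h2
      omega
    · exact mem_biUnion.2 ⟨e, he, mem_powersetCard.2 ⟨hJe, hC J hJ⟩⟩
  exact ⟨hs, (card_le_card hs).trans (card_shad j k R (fun e he => hE e (h.1 he)))⟩

lemma wit_bad {V : Type*} [DecidableEq V] [Fintype V] {j k : ℕ}
    {E1 E2 C R B : Finset (Finset V)} (hE1 : ∀ t ∈ E1, t.card = k) (hE2 : ∀ t ∈ E2, t.card = k)
    (hC : ∀ J ∈ C, J.card = j) (h2 : 2 ≤ C.card) (hR : Wit j k E1 C R) (hB : Wit j k E2 C B)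
    (hle : R.card ≤ B.card) : BadEv j k R.card E1 E2 := by
  obtain ⟨J, hJ⟩ := card_pos.1 (show 0 < C.card by omega)
  obtain ⟨B', hB', hBc⟩ := exists_subset_card_eq hle
  have hs := (wit_lower hE1 hC h2 hR).1
  refine ⟨J, mem_powersetCard.2 ⟨subset_univ _, hC J hJ⟩, R, rfl, hR.2.2.1 J hJ,
    fun e he => hE1 e (hR.1 he), hR.1, B', ?_, hBc, hB'.trans hB.1⟩
  intro e he
  obtain ⟨J, hJ, J', hJ', hx⟩ := hB.2.2.2.2 e (hB' he)
  simp only [adm, mem_filter, mem_univ, true_and]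
  exact ⟨hE2 e (hB.1 (hB' he)), J, hs hJ, J', hs hJ', hx⟩

lemma perc_bad {V : Type*} [DecidableEq V] [Fintype V] {j k : ℕ} (hjk : j ≤ k)
    {E1 E2 : Finset (Finset V)} (hE1 : ∀ t ∈ E1, t.card = k) (hE2 : ∀ t ∈ E2, t.card = k)
    (hP : JPercolates j E1 E2) {l : ℕ} (hl : 2 ≤ l)
    (hbig : k.choose j * l ≤ ((univ : Finset V).powersetCard j).card) :
    ∃ r ∈ Icc l (2 * (k.choose j * l)), BadEv j k r E1 E2 ∨ BadEv j k r E2 E1 := by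
  have hK : 0 < k.choose j := Nat.choose_pos hjk
  have hL : 2 ≤ k.choose j * l := by nlinarith
  obtain ⟨C, R, B, hC1, hC2, hCj, hR, hB⟩ := exists_mid_cluster hjk hE1 hE2 hP hL hbig
  have hc2 : 2 ≤ C.card := hL.trans hC1
  have l1 := (wit_lower hE1 hCj hc2 hR).2
  have l2 := (wit_lower hE2 hCj hc2 hB).2
  have u1 := hR.2.1
  have u2 := hB.2.1
  have m1 : l ≤ R.card := by
    have : k.choose j * l ≤ k.choose j * R.card := by rw [mul_comm _ R.card]; omega
    exact Nat.le_of_mul_le_mul_left this hK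
  have m2 : l ≤ B.card := by
    have : k.choose j * l ≤ k.choose j * B.card := by rw [mul_comm _ B.card]; omega
    exact Nat.le_of_mul_le_mul_left this hK
  rcases le_total R.card B.card with hle | hle
  · exact ⟨R.card, mem_Icc.2 ⟨m1, by omega⟩, Or.inl (wit_bad hE1 hE2 hCj hc2 hR hB hle)⟩
  · exact ⟨B.card, mem_Icc.2 ⟨m2, by omega⟩, Or.inr (wit_bad hE2 hE1 hCj hc2 hB hR hle)⟩

/-- binomial weight -/
noncomputable def wt {α : Type*} (K : Finset α) (p : ℝ) (E : Finset α) : ℝ :=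
  p ^ E.card * (1 - p) ^ (K.card - E.card)

lemma wt_nonneg {α : Type*} (K : Finset α) {p : ℝ} (h0 : 0 ≤ p) (h1 : p ≤ 1) (E : Finset α) :
    0 ≤ wt K p E :=
  mul_nonneg (pow_nonneg h0 _) (pow_nonneg (by linarith) _)

lemma wt_sum {α : Type*} (K : Finset α) (p : ℝ) : ∑ E ∈ K.powerset, wt K p E = 1 := by
  unfold wt
  rw [Finset.sum_pow_mul_eq_add_pow]
  simp

lemma wt_sum_superset {α : Type*} [DecidableEq α] (K : Finset α) {p : ℝ}
    (R : Finset α) (hR : R ⊆ K) :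
    ∑ E ∈ K.powerset.filter (fun E => R ⊆ E), wt K p E = p ^ R.card := by
  have h : K.powerset.filter (fun E => R ⊆ E) = (K \ R).powerset.image (R ∪ ·) := by
    rw [← Finset.Icc_eq_image_powerset hR]
    ext E
    simp only [mem_filter, mem_powerset, mem_Icc]
    tauto
  have hdis : ∀ E ∈ (K \ R).powerset, Disjoint R E := by
    intro E hE
    rw [mem_powerset] at hE
    exact disjoint_of_subset_right hE disjoint_sdiff
  rw [h, sum_image]
  · have : ∀ E ∈ (K \ R).powerset, wt K p (R ∪ E) = p ^ R.card * wt (K \ R) p E := by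
      intro E hE
      unfold wt
      rw [card_union_of_disjoint (hdis E hE), card_sdiff_of_subset hR, pow_add, Nat.sub_add_eq]
      ring
    rw [sum_congr rfl this, ← mul_sum, wt_sum, mul_one]
  · intro E hE E' hE' heq
    simp only at heq
    have e1 := hdis E hE
    have e2 := hdis E' hE'
    rw [← union_sdiff_cancel_left e1, heq, union_sdiff_cancel_left e2]

section prob
open scoped Classical

lemma probDouble_eq {α : Type*} [DecidableEq α] (K : Finset α) (p1 p2 : ℝ)
    (A : Finset α → Finset α → Prop) : probDouble K p1 p2 A =
    ∑ x ∈ K.powerset ×ˢ K.powerset, if A x.1 x.2 then wt K p1 x.1 * wt K p2 x.2 else 0 := by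
  unfold probDouble wt
  rw [sum_product]
  refine sum_congr rfl fun E1 _ => sum_congr rfl fun E2 _ => ?_
  congr 1
  ring

lemma probDouble_mono {α : Type*} [DecidableEq α] (K : Finset α) {p1 p2 : ℝ}
    (h1 : 0 ≤ p1 ∧ p1 ≤ 1) (h2 : 0 ≤ p2 ∧ p2 ≤ 1) {A A' : Finset α → Finset α → Prop}
    (h : ∀ E1 E2, E1 ⊆ K → E2 ⊆ K → A E1 E2 → A' E1 E2) :
    probDouble K p1 p2 A ≤ probDouble K p1 p2 A' := by
  rw [probDouble_eq, probDouble_eq]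
  refine sum_le_sum ?_
  rintro ⟨E1, E2⟩ hx
  simp only [mem_product, mem_powerset] at hx
  have hw := mul_nonneg (wt_nonneg K h1.1 h1.2 E1) (wt_nonneg K h2.1 h2.2 E2)
  by_cases hA : A E1 E2
  · have := h E1 E2 hx.1 hx.2 hA
    simp [hA, this]
  · simp only [hA, if_false]
    split_ifs
    · exact hw
    · exact le_rfl

lemma probDouble_union {α ι : Type*} [DecidableEq α] (K : Finset α) {p1 p2 : ℝ}
    (h1 : 0 ≤ p1 ∧ p1 ≤ 1) (h2 : 0 ≤ p2 ∧ p2 ≤ 1) (s : Finset ι)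
    (A : ι → Finset α → Finset α → Prop) :
    probDouble K p1 p2 (fun E1 E2 => ∃ i ∈ s, A i E1 E2) ≤ ∑ i ∈ s, probDouble K p1 p2 (A i) := by
  simp only [probDouble_eq]
  rw [sum_comm]
  refine sum_le_sum ?_
  rintro ⟨E1, E2⟩ _
  have hw := mul_nonneg (wt_nonneg K h1.1 h1.2 E1) (wt_nonneg K h2.1 h2.2 E2)
  have hnn : ∀ i ∈ s, (0:ℝ) ≤ if A i E1 E2 then wt K p1 E1 * wt K p2 E2 else 0 := by
    intro i _
    split_ifs
    · exact hw
    · exact le_rfl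
  by_cases hx : ∃ i ∈ s, A i E1 E2
  · obtain ⟨i, hi, hA⟩ := hx
    have := single_le_sum hnn hi
    simp only [hA, if_true] at this
    rw [if_pos ⟨i, hi, hA⟩]
    exact this
  · rw [if_neg hx]
    exact sum_nonneg hnn

lemma probDouble_or {α : Type*} [DecidableEq α] (K : Finset α) {p1 p2 : ℝ}
    (h1 : 0 ≤ p1 ∧ p1 ≤ 1) (h2 : 0 ≤ p2 ∧ p2 ≤ 1) (A B : Finset α → Finset α → Prop) :
    probDouble K p1 p2 (fun E1 E2 => A E1 E2 ∨ B E1 E2)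
      ≤ probDouble K p1 p2 A + probDouble K p1 p2 B := by
  have := probDouble_union K h1 h2 (univ : Finset Bool) (fun b => if b then A else B)
  simp only [Fintype.sum_bool, if_true] at this
  refine le_trans (probDouble_mono K h1 h2 ?_) this
  rintro E1 E2 _ _ (h | h)
  · exact ⟨true, mem_univ _, by simpa using h⟩
  · exact ⟨false, mem_univ _, by simpa using h⟩

lemma probDouble_swap {α : Type*} [DecidableEq α] (K : Finset α) (p1 p2 : ℝ)
    (A : Finset α → Finset α → Prop) :
    probDouble K p1 p2 (fun E1 E2 => A E2 E1) = probDouble K p2 p1 A := by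
  unfold probDouble
  rw [sum_comm]
  refine sum_congr rfl fun E1 _ => sum_congr rfl fun E2 _ => ?_
  congr 1
  ring

lemma probDouble_compl {α : Type*} [DecidableEq α] (K : Finset α) (p1 p2 : ℝ)
    (A : Finset α → Finset α → Prop) :
    probDouble K p1 p2 (fun E1 E2 => ¬ A E1 E2) = 1 - probDouble K p1 p2 A := by
  rw [eq_sub_iff_add_eq, probDouble_eq, probDouble_eq, ← sum_add_distrib]
  refine (sum_congr rfl (g := fun x => wt K p1 x.1 * wt K p2 x.2) ?_).trans ?_
  · intro x _
    by_cases h : A x.1 x.2 <;> simp [h]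
  · rw [sum_product, ← sum_mul_sum, wt_sum, wt_sum, one_mul]

lemma probDouble_nonneg {α : Type*} [DecidableEq α] (K : Finset α) {p1 p2 : ℝ}
    (h1 : 0 ≤ p1 ∧ p1 ≤ 1) (h2 : 0 ≤ p2 ∧ p2 ≤ 1) (A : Finset α → Finset α → Prop) :
    0 ≤ probDouble K p1 p2 A := by
  rw [probDouble_eq]
  refine sum_nonneg fun x _ => ?_
  split_ifs
  · exact mul_nonneg (wt_nonneg K h1.1 h1.2 _) (wt_nonneg K h2.1 h2.2 _)
  · exact le_rfl

lemma probDouble_contains {α : Type*} [DecidableEq α] (K : Finset α) {p1 p2 : ℝ}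
    (R B : Finset α) (hR : R ⊆ K) (hB : B ⊆ K) :
    probDouble K p1 p2 (fun E1 E2 => R ⊆ E1 ∧ B ⊆ E2) = p1 ^ R.card * p2 ^ B.card := by
  rw [probDouble_eq, ← wt_sum_superset K R hR, ← wt_sum_superset K B hB, sum_mul_sum,
    ← sum_product', ← filter_product, sum_filter]
  refine sum_congr rfl fun x _ => ?_
  by_cases h : R ⊆ x.1 ∧ B ⊆ x.2 <;> simp [h]

lemma prob_bad {n : ℕ} (hn : 1 ≤ n) (j k r : ℕ) {p1 p2 : ℝ}
    (h1 : 0 ≤ p1 ∧ p1 ≤ 1) (h2 : 0 ≤ p2 ∧ p2 ≤ 1) :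
    probHk n k p1 p2 (BadEv j k r) ≤
      (n : ℝ) ^ j * ((k.choose j * n ^ (k - j) * (1 + r)).choose r : ℝ) *
        ((((r * k.choose j) ^ 2 * n ^ (k - (j + 1))).choose r : ℕ) : ℝ) * (p1 * p2) ^ r := by
  unfold probHk
  set K := (univ : Finset (Fin n)).powersetCard k with hK
  have hmemK : ∀ t, t ∈ K ↔ t.card = k := by
    intro t
    simp [hK, mem_powersetCard]
  set RR : Finset (Fin n) → Finset (Finset (Finset (Fin n))) := fun J =>
    ((univ.powersetCard r).filter (fun S => CutConn (nbh j k) {J} S)).filter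
      (fun S => ∀ e ∈ S, e.card = k) with hRR
  set M := ((r * k.choose j) ^ 2 * n ^ (k - (j + 1))).choose r with hM
  have hB : ∀ J, ∀ R ∈ RR J, probDouble K p1 p2
      (fun E1 E2 => ∃ B ∈ (adm j k R).powersetCard r, R ⊆ E1 ∧ B ⊆ E2) ≤ M * (p1 * p2) ^ r := by
    intro J R hR
    simp only [hRR, mem_filter, mem_powersetCard] at hR
    obtain ⟨⟨⟨_, hRc⟩, _⟩, hRk⟩ := hR
    refine (probDouble_union K h1 h2 _ _).trans ?_
    have : ∀ B ∈ (adm j k R).powersetCard r,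
        probDouble K p1 p2 (fun E1 E2 => R ⊆ E1 ∧ B ⊆ E2) = (p1 * p2) ^ r := by
      intro B hB
      rw [mem_powersetCard] at hB
      rw [probDouble_contains, hRc, hB.2, mul_pow]
      · intro e he
        exact (hmemK e).2 (hRk e he)
      · intro e he
        have := hB.1 he
        simp only [adm, mem_filter] at this
        exact (hmemK e).2 this.2.1
    rw [sum_congr rfl this, sum_const, nsmul_eq_mul, card_powersetCard]
    refine mul_le_mul_of_nonneg_right ?_ (pow_nonneg (mul_nonneg h1.1 h2.1) _)
    rw [hM]
    have := card_adm hn j k R hRk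
    rw [hRc] at this
    exact_mod_cast Nat.choose_le_choose r this
  have hRcard : ∀ J, (RR J).card ≤ (k.choose j * n ^ (k - j) * (1 + r)).choose r := by
    intro J
    refine (card_filter_le _ _).trans ?_
    exact cutConn_count (nbh j k) _ (card_nbh hn j k) (1 + r) {J} r (by simp)
  have hMn : (0:ℝ) ≤ M * (p1 * p2) ^ r :=
    mul_nonneg (Nat.cast_nonneg _) (pow_nonneg (mul_nonneg h1.1 h2.1) _)
  have hJ : ∀ J, probDouble K p1 p2 (fun E1 E2 => ∃ R ∈ RR J,
      ∃ B ∈ (adm j k R).powersetCard r, R ⊆ E1 ∧ B ⊆ E2) ≤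
      ((k.choose j * n ^ (k - j) * (1 + r)).choose r : ℕ) * (M * (p1 * p2) ^ r) := by
    intro J
    refine (probDouble_union K h1 h2 _ _).trans ((sum_le_sum (hB J)).trans ?_)
    rw [sum_const, nsmul_eq_mul]
    exact mul_le_mul_of_nonneg_right (by exact_mod_cast hRcard J) hMn
  have hfin : probDouble K p1 p2 (BadEv j k r) ≤ probDouble K p1 p2 (fun E1 E2 =>
      ∃ J ∈ (univ : Finset (Fin n)).powersetCard j, ∃ R ∈ RR J,
      ∃ B ∈ (adm j k R).powersetCard r, R ⊆ E1 ∧ B ⊆ E2) := by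
    refine probDouble_mono K h1 h2 ?_
    rintro E1 E2 _ _ ⟨J, hJ, R, hRc, hcon, hRk, hRE, B, hBa, hBc, hBE⟩
    refine ⟨J, hJ, R, ?_, B, mem_powersetCard.2 ⟨hBa, hBc⟩, hRE, hBE⟩
    simp only [hRR, mem_filter, mem_powersetCard]
    exact ⟨⟨⟨subset_univ _, hRc⟩, hcon⟩, hRk⟩
  refine hfin.trans ((probDouble_union K h1 h2 _ _).trans
    ((sum_le_sum (fun J _ => hJ J)).trans ?_))
  rw [sum_const, nsmul_eq_mul]
  rw [show ∀ a b c d : ℝ, a * b * c * d = a * (b * (c * d)) from fun a b c d => by ring]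
  refine mul_le_mul_of_nonneg_right ?_ (mul_nonneg (Nat.cast_nonneg _) hMn)
  rw [card_powersetCard, card_univ, Fintype.card_fin]
  exact_mod_cast Nat.choose_le_pow _ _

end prob

lemma choose_le_exp (N r : ℕ) (x y : ℝ) (hx : 0 ≤ x) (hy : 0 ≤ y) (h : (N : ℝ) ≤ x * y) :
    (N.choose r : ℝ) ≤ y ^ r * Real.exp x := by
  have h1 : (N.choose r : ℝ) ≤ (N : ℝ) ^ r / (r.factorial : ℝ) := Nat.choose_le_pow_div r N
  have h2 := Real.pow_div_factorial_le_exp x hx r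
  have h3 : (0:ℝ) < r.factorial := by exact_mod_cast r.factorial_pos
  calc (N.choose r : ℝ) ≤ (N : ℝ) ^ r / (r.factorial : ℝ) := h1
    _ ≤ (x * y) ^ r / (r.factorial : ℝ) := by gcongr
    _ = y ^ r * (x ^ r / (r.factorial : ℝ)) := by rw [mul_pow]; ring
    _ ≤ y ^ r * Real.exp x := by gcongr

/-- Numerical estimate. -/
lemma bad_numeric {n : ℕ} (hn : 3 ≤ n) (j k r : ℕ) (hjk : j + 1 ≤ k) {q : ℝ} (hq0 : 0 ≤ q)
    (hr1 : Real.log n ≤ r) (hr2 : (r : ℝ) ≤ 4 * k.choose j * Real.log n)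
    (hq : q ≤ 1 / ((4 * (k.choose j : ℝ) ^ 4 * Real.exp (j + 4)) *
      (n : ℝ) ^ (2 * k - 2 * j - 1) * Real.log n)) :
    (n : ℝ) ^ j * ((k.choose j * n ^ (k - j) * (1 + r)).choose r : ℝ) *
        ((((r * k.choose j) ^ 2 * n ^ (k - (j + 1))).choose r : ℕ) : ℝ) * q ^ r
      ≤ Real.exp 1 / (n : ℝ) ^ 2 := by
  have hnpos : (0:ℝ) < n := by exact_mod_cast (show 0 < n by omega)
  have hlog : 0 < Real.log n := Real.log_pos (by exact_mod_cast (show 1 < n by omega))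
  set K : ℝ := (k.choose j : ℝ) with hK
  have hKpos : 0 < K := by
    rw [hK]; exact_mod_cast Nat.choose_pos (show j ≤ k by omega)
  have c1 : ((k.choose j * n ^ (k - j) * (1 + r)).choose r : ℝ) ≤
      (K * (n:ℝ) ^ (k - j)) ^ r * Real.exp (1 + r) := by
    refine choose_le_exp _ _ _ _ (by positivity) (by positivity) ?_
    push_cast
    rw [mul_comm]
  have c2 : ((((r * k.choose j) ^ 2 * n ^ (k - (j + 1))).choose r : ℕ) : ℝ) ≤
      (r * K ^ 2 * (n:ℝ) ^ (k - (j + 1))) ^ r * Real.exp r := by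
    refine choose_le_exp _ _ _ _ (by positivity) (by positivity) ?_
    push_cast
    apply le_of_eq
    ring
  have hpow : (n:ℝ) ^ (k - j) * (n:ℝ) ^ (k - (j + 1)) = (n:ℝ) ^ (2 * k - 2 * j - 1) := by
    rw [← pow_add]
    congr 1
    omega
  have hexp : Real.exp ((j:ℝ) + 4) = Real.exp (j + 2) * Real.exp 1 * Real.exp 1 := by
    rw [← Real.exp_add, ← Real.exp_add]; congr 1; ring
  have hbase : K * (n:ℝ) ^ (k - j) * (r * K ^ 2 * (n:ℝ) ^ (k - (j + 1))) * q * Real.exp 1 * Real.exp 1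
      ≤ Real.exp (-(j + 2)) := by
    have hN : (0:ℝ) < (n:ℝ) ^ (2 * k - 2 * j - 1) := by positivity
    calc K * (n:ℝ) ^ (k - j) * (r * K ^ 2 * (n:ℝ) ^ (k - (j + 1))) * q * Real.exp 1 * Real.exp 1
        = K ^ 3 * (n:ℝ) ^ (2 * k - 2 * j - 1) * r * q * Real.exp 1 * Real.exp 1 := by
          rw [← hpow]; ring
      _ ≤ K ^ 3 * (n:ℝ) ^ (2 * k - 2 * j - 1) * (4 * K * Real.log n) *
          (1 / ((4 * K ^ 4 * Real.exp (j + 4)) * (n : ℝ) ^ (2 * k - 2 * j - 1) * Real.log n))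
            * Real.exp 1 * Real.exp 1 := by gcongr
      _ = Real.exp (-(j + 2)) := by
          rw [hexp, Real.exp_neg]
          have := Real.exp_pos (1:ℝ)
          have := Real.exp_pos ((j:ℝ) + 2)
          field_simp
  calc _ ≤ (n : ℝ) ^ j * ((K * (n:ℝ) ^ (k - j)) ^ r * Real.exp (1 + r)) *
        ((r * K ^ 2 * (n:ℝ) ^ (k - (j + 1))) ^ r * Real.exp r) * q ^ r := by gcongr
    _ = (n : ℝ) ^ j * Real.exp 1 * (K * (n:ℝ) ^ (k - j) * (r * K ^ 2 * (n:ℝ) ^ (k - (j + 1))) * q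
          * Real.exp 1 * Real.exp 1) ^ r := by
        have : Real.exp (r:ℝ) = Real.exp 1 ^ r := by rw [← Real.exp_nat_mul, mul_one]
        rw [Real.exp_add, this]
        simp only [mul_pow]
        ring
    _ ≤ (n : ℝ) ^ j * Real.exp 1 * (Real.exp (-(j + 2))) ^ r := by gcongr
    _ ≤ (n : ℝ) ^ j * Real.exp 1 * ((n : ℝ) ^ (j + 2))⁻¹ := by
        gcongr
        rw [← Real.exp_nat_mul]
        have : ((n : ℝ) ^ (j + 2))⁻¹ = Real.exp (-(((j + 2 : ℕ) : ℝ) * Real.log n)) := by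
          rw [Real.exp_neg, Real.exp_nat_mul, Real.exp_log hnpos]
        rw [this]
        apply Real.exp_le_exp.2
        push_cast
        nlinarith
    _ = Real.exp 1 / (n : ℝ) ^ 2 := by
        rw [pow_add]
        field_simp

lemma prob_perc {n : ℕ} (hn : 3 ≤ n) (j k l : ℕ) (hjk : j + 1 ≤ k) {p1 p2 : ℝ}
    (h1 : 0 ≤ p1 ∧ p1 ≤ 1) (h2 : 0 ≤ p2 ∧ p2 ≤ 1)
    (hl2 : 2 ≤ l) (hl : Real.log n ≤ l) (hl' : (l : ℝ) ≤ 2 * Real.log n)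
    (hbig : k.choose j * l ≤ n.choose j) (hcnt : 2 * (k.choose j * l) ≤ n)
    (hq : p1 * p2 ≤ 1 / ((4 * (k.choose j : ℝ) ^ 4 * Real.exp (j + 4)) *
      (n : ℝ) ^ (2 * k - 2 * j - 1) * Real.log n)) :
    probHk n k p1 p2 (JPercolates j) ≤ 2 * Real.exp 1 / n := by
  have hnpos : (0:ℝ) < n := by exact_mod_cast (show 0 < n by omega)
  have hmem : ∀ E, E ⊆ (univ : Finset (Fin n)).powersetCard k → ∀ t ∈ E, t.card = k :=
    fun E hE t ht => (mem_powersetCard.1 (hE ht)).2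
  have a1 : probHk n k p1 p2 (JPercolates j) ≤ probHk n k p1 p2 (fun E1 E2 =>
      ∃ r ∈ Icc l (2 * (k.choose j * l)), BadEv j k r E1 E2 ∨ BadEv j k r E2 E1) := by
    refine probDouble_mono _ h1 h2 ?_
    intro E1 E2 hE1 hE2 hP
    refine perc_bad (by omega) (hmem E1 hE1) (hmem E2 hE2) hP hl2 ?_
    rw [card_powersetCard, card_univ, Fintype.card_fin]
    exact hbig
  have a2 : ∀ r ∈ Icc l (2 * (k.choose j * l)), probHk n k p1 p2 (fun E1 E2 =>
      BadEv j k r E1 E2 ∨ BadEv j k r E2 E1) ≤ 2 * (Real.exp 1 / (n : ℝ) ^ 2) := by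
    intro r hr
    rw [mem_Icc] at hr
    have hr1 : Real.log n ≤ r := hl.trans (by exact_mod_cast hr.1)
    have hr2 : (r : ℝ) ≤ 4 * k.choose j * Real.log n := by
      have h : (r : ℝ) ≤ 2 * (k.choose j * l) := by exact_mod_cast hr.2
      have h' : (k.choose j : ℝ) * l ≤ k.choose j * (2 * Real.log n) := by gcongr
      linarith
    refine (probDouble_or _ h1 h2 _ _).trans ?_
    have b1 := (prob_bad (show 1 ≤ n by omega) j k r h1 h2).trans
      (bad_numeric hn j k r hjk (mul_nonneg h1.1 h2.1) hr1 hr2 hq)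
    have b2 := (prob_bad (show 1 ≤ n by omega) j k r h2 h1).trans
      (bad_numeric hn j k r hjk (mul_nonneg h2.1 h1.1) hr1 hr2 (by rwa [mul_comm p2 p1]))
    have b3 := probDouble_swap ((univ : Finset (Fin n)).powersetCard k) p1 p2 (BadEv j k r)
    unfold probHk at b1 b2
    rw [b3]
    linarith
  refine a1.trans ((probDouble_union _ h1 h2 _ _).trans ((sum_le_sum a2).trans ?_))
  rw [sum_const, nsmul_eq_mul, Nat.card_Icc]
  have hc : ((2 * (k.choose j * l) + 1 - l : ℕ) : ℝ) ≤ n := by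
    exact_mod_cast (show 2 * (k.choose j * l) + 1 - l ≤ n by omega)
  calc _ ≤ (n:ℝ) * (2 * (Real.exp 1 / (n : ℝ) ^ 2)) := by gcongr
    _ = _ := by field_simp

/-- **Theorem (subcritical regime).** For integers `1 ≤ j ≤ k−1` there exists a constant
`c = c(k,j) > 0` such that: if `0 ≤ p1(n), p2(n) ≤ 1` and
`p1·p2 ≤ 1/(c·n^{2k−2j−1}·log n)`, then whp `H ~ H_k(n,p1,p2)` does not `j`-percolate. -/
theorem jigsaw_hypergraph_subcritical (k j : ℕ) (hj : 1 ≤ j) (hjk : j ≤ k - 1) :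
    ∃ c : ℝ, 0 < c ∧
      ∀ p1 p2 : ℕ → ℝ,
        (∀ n, 0 ≤ p1 n ∧ p1 n ≤ 1) →
        (∀ n, 0 ≤ p2 n ∧ p2 n ≤ 1) →
        (∀ᶠ n : ℕ in atTop,
          p1 n * p2 n ≤ 1 / (c * (n : ℝ) ^ (2 * k - 2 * j - 1) * Real.log n)) →
        Tendsto
          (fun n : ℕ => probHk n k (p1 n) (p2 n) fun E1 E2 => ¬ JPercolates j E1 E2)
          atTop (nhds 1) := by
  have hjk' : j + 1 ≤ k := by omega
  have hKpos : 0 < k.choose j := Nat.choose_pos (show j ≤ k by omega)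
  have hKr : (0:ℝ) < k.choose j := by exact_mod_cast hKpos
  refine ⟨4 * (k.choose j : ℝ) ^ 4 * Real.exp (j + 4), by positivity, ?_⟩
  intro p1 p2 h1 h2 hq
  have hlogn : Tendsto (fun n : ℕ => Real.log n) atTop atTop :=
    Real.tendsto_log_atTop.comp tendsto_natCast_atTop_atTop
  have hsmall : ∀ᶠ n : ℕ in atTop, 4 * (k.choose j : ℝ) * Real.log n ≤ n := by
    have h := (Real.isLittleO_log_id_atTop.comp_tendsto
      (tendsto_natCast_atTop_atTop (R := ℝ))).bound
      (show (0:ℝ) < 1 / (4 * k.choose j) by positivity)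
    filter_upwards [h, eventually_ge_atTop 1] with n hn hn1
    simp only [Function.comp, id, Real.norm_eq_abs, Nat.abs_cast] at hn
    have h' := (le_abs_self _).trans hn
    rw [div_mul_eq_mul_div, one_mul, le_div_iff₀ (by positivity)] at h'
    linarith
  have hub : ∀ᶠ n : ℕ in atTop, probHk n k (p1 n) (p2 n) (JPercolates j) ≤ 2 * Real.exp 1 / n := by
    filter_upwards [hq, hsmall, hlogn.eventually_ge_atTop 2, eventually_ge_atTop (3 + 2 * j)]
      with n hqn hs hl hn
    have hceil := Nat.ceil_lt_add_one (show 0 ≤ Real.log n by linarith)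
    have hceil' := Nat.le_ceil (Real.log n)
    have hcnt : 2 * (k.choose j * ⌈Real.log n⌉₊) ≤ n := by
      have : (2:ℝ) * (k.choose j * ⌈Real.log n⌉₊) ≤ n := by
        have : (k.choose j : ℝ) * ⌈Real.log n⌉₊ ≤ k.choose j * (2 * Real.log n) := by
          gcongr
          linarith
        linarith
      exact_mod_cast this
    refine prob_perc (by omega) j k ⌈Real.log n⌉₊ hjk' (h1 n) (h2 n) ?_ hceil' ?_ ?_ hcnt hqn
    · have : (2:ℝ) ≤ ⌈Real.log n⌉₊ := by linarith
      exact_mod_cast this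
    · linarith
    · have hnc : n ≤ 2 * n.choose j := by
        have : n.choose 1 ≤ n.choose j := by
          have hm : ∀ i, 1 ≤ i → i ≤ j → n.choose 1 ≤ n.choose i := by
            intro i hi
            induction i, hi using Nat.le_induction with
            | base => intro _; exact le_rfl
            | succ i hi ih =>
              intro hij
              exact (ih (by omega)).trans (Nat.choose_le_succ_of_lt_half_left (by omega))
          exact hm j hj le_rfl
        rw [Nat.choose_one_right] at this
        omega
      omega
  have hlim : Tendsto (fun n : ℕ => 2 * Real.exp 1 / (n:ℝ)) atTop (nhds 0) :=
    tendsto_const_div_atTop_nhds_zero_nat _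
  have h0 : Tendsto (fun n : ℕ => probHk n k (p1 n) (p2 n) (JPercolates j)) atTop (nhds 0) :=
    tendsto_of_tendsto_of_tendsto_of_le_of_le' tendsto_const_nhds hlim
      (Eventually.of_forall fun n => probDouble_nonneg _ (h1 n) (h2 n) _) hub
  have h3 := h0.const_sub 1
  rw [sub_zero] at h3
  refine h3.congr fun n => ?_
  exact (probDouble_compl _ _ _ _).symm
end

section
/- For integers 1 ≤ j ≤ k−1 there exists a constant c = c(k,j) > 0 such that the following holds. Let 0 ≤ p1 = p1(n), p2 = p2(n) ≤ 1 and let H ∼ H_k(n,p1,p2). If p1·p2 ≥ c/(n^{2k−2j−1}·log n) and min{p1,p2} ≥ c·log n/n^{k−j}, then with high probability H j-percolates. -/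
open Finset Filter

noncomputable def Ex {β : Type*} [DecidableEq β] (p : β → ℝ) (K : Finset β) (f : Finset β → ℝ) : ℝ :=
  ∑ E ∈ K.powerset, (∏ e ∈ E, p e) * (∏ e ∈ K \ E, (1 - p e)) * f E

open scoped Classical in
noncomputable def ind (P : Prop) : ℝ := if P then 1 else 0

lemma ind_nonneg (P : Prop) : 0 ≤ ind P := by unfold ind; split_ifs <;> norm_num
lemma ind_le_one (P : Prop) : ind P ≤ 1 := by unfold ind; split_ifs <;> norm_num
lemma ind_true {P : Prop} (h : P) : ind P = 1 := by unfold ind; simp [h]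
lemma ind_false {P : Prop} (h : ¬ P) : ind P = 0 := by unfold ind; simp [h]
lemma ind_not (P : Prop) : ind (¬ P) = 1 - ind P := by
  by_cases h : P <;> simp [ind, h]
lemma ind_mono {P Q : Prop} (h : P → Q) : ind P ≤ ind Q := by
  by_cases hp : P
  · rw [ind_true hp, ind_true (h hp)]
  · rw [ind_false hp]; exact ind_nonneg _

section
variable {β : Type*} [DecidableEq β] {p : β → ℝ}

lemma Ex_congr {K : Finset β} {f g : Finset β → ℝ} (h : ∀ E ⊆ K, f E = g E) :
    Ex p K f = Ex p K g := by
  unfold Ex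
  refine sum_congr rfl fun E hE => ?_
  rw [h E (mem_powerset.1 hE)]

lemma Ex_mono (hp : ∀ e, 0 ≤ p e ∧ p e ≤ 1) {K : Finset β} {f g : Finset β → ℝ}
    (h : ∀ E ⊆ K, f E ≤ g E) : Ex p K f ≤ Ex p K g := by
  unfold Ex
  refine sum_le_sum fun E hE => ?_
  refine mul_le_mul_of_nonneg_left (h E (mem_powerset.1 hE)) ?_
  exact mul_nonneg (prod_nonneg fun e _ => (hp e).1)
    (prod_nonneg fun e _ => by linarith [(hp e).2])

lemma Ex_add (K : Finset β) (f g : Finset β → ℝ) :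
    Ex p K (fun E => f E + g E) = Ex p K f + Ex p K g := by
  unfold Ex; simp [mul_add, sum_add_distrib]

lemma Ex_mul_left (K : Finset β) (a : ℝ) (f : Finset β → ℝ) :
    Ex p K (fun E => a * f E) = a * Ex p K f := by
  unfold Ex; rw [mul_sum]; refine sum_congr rfl fun E _ => by ring

lemma Ex_sum {ι : Type*} (s : Finset ι) (K : Finset β) (f : ι → Finset β → ℝ) :
    Ex p K (fun E => ∑ i ∈ s, f i E) = ∑ i ∈ s, Ex p K (f i) := by
  unfold Ex; simp only [mul_sum]; rw [sum_comm]

lemma Ex_const (K : Finset β) (a : ℝ) : Ex p K (fun _ => a) = a := by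
  unfold Ex
  rw [← sum_mul, ← Finset.prod_add]; simp

lemma Ex_nonneg (hp : ∀ e, 0 ≤ p e ∧ p e ≤ 1) {K : Finset β} {f : Finset β → ℝ}
    (h : ∀ E ⊆ K, 0 ≤ f E) : 0 ≤ Ex p K f := by
  have := Ex_mono (p := p) hp h
  rwa [Ex_const] at this

lemma Ex_empty (f : Finset β → ℝ) : Ex p ∅ f = f ∅ := by simp [Ex]

lemma Ex_insert {K : Finset β} {a : β} (ha : a ∉ K) (f : Finset β → ℝ) :
    Ex p (insert a K) f = p a * Ex p K (fun E => f (insert a E)) + (1 - p a) * Ex p K f := by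
  unfold Ex
  rw [sum_powerset_insert ha, add_comm, mul_sum, mul_sum]
  congr 1
  · refine sum_congr rfl fun E hE => ?_
    have hE := mem_powerset.1 hE
    have haE : a ∉ E := fun h => ha (hE h)
    rw [prod_insert haE]
    have : insert a K \ insert a E = K \ E := by
      ext x; simp only [Finset.mem_sdiff, mem_insert]; grind
    rw [this]; ring
  · refine sum_congr rfl fun E hE => ?_
    have hE := mem_powerset.1 hE
    have haE : a ∉ E := fun h => ha (hE h)
    have : insert a K \ E = insert a (K \ E) := by
      ext x; simp only [Finset.mem_sdiff, mem_insert]; grind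
    rw [this, prod_insert (by simp [ha])]; ring

lemma Ex_union {S K : Finset β} (h : Disjoint S K) (f : Finset β → ℝ) :
    Ex p (S ∪ K) f = Ex p S (fun F => Ex p K (fun E => f (F ∪ E))) := by
  induction S using Finset.induction_on generalizing f with
  | empty => simp [Ex_empty]
  | insert a S ha ih =>
    rw [disjoint_insert_left] at h
    rw [insert_union, Ex_insert (by simp [ha, h.1]), Ex_insert ha, ih h.2, ih h.2]
    simp only [insert_union]

lemma Ex_split {S K : Finset β} (h : S ⊆ K) (f : Finset β → ℝ) :
    Ex p K f = Ex p S (fun F => Ex p (K \ S) (fun E => f (F ∪ E))) := by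
  rw [← Ex_union disjoint_sdiff, union_sdiff_of_subset h]

lemma Ex_marginal {S K : Finset β} (h : S ⊆ K) (f : Finset β → ℝ) :
    Ex p K (fun E => f (E ∩ S)) = Ex p S f := by
  rw [Ex_split h]
  refine Ex_congr fun F hF => ?_
  rw [Ex_congr (g := fun _ => f F), Ex_const]
  intro E hE
  congr 1
  ext x
  have := @hE x; have := @hF x
  simp only [Finset.mem_sdiff, mem_inter, mem_union] at *
  grind

/-- Pushforward. -/
lemma Ex_push {ι : Type*} [DecidableEq ι] (I : Finset ι) (S : ι → Finset β)
    (hS : ∀ i ∈ I, ∀ i' ∈ I, i ≠ i' → Disjoint (S i) (S i'))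
    (A : ι → Finset β → Prop) [∀ i E, Decidable (A i E)] (f : Finset ι → ℝ) :
    Ex p (I.biUnion S) (fun E => f (I.filter (fun i => A i (E ∩ S i)))) =
      Ex (fun i => Ex p (S i) (fun E => ind (A i E))) I f := by
  induction I using Finset.induction_on generalizing f with
  | empty => simp [Ex_empty]
  | insert a I ha ih =>
    have hd : Disjoint (S a) (I.biUnion S) := by
      rw [disjoint_biUnion_right]
      intro i hi
      exact hS a (by simp) i (by simp [hi]) (by rintro rfl; exact ha hi)
    have ih' := ih (fun i hi i' hi' => hS i (by simp [hi]) i' (by simp [hi']))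
    rw [biUnion_insert, Ex_union hd, Ex_insert ha]
    set π : ι → ℝ := fun i => Ex p (S i) (fun E => ind (A i E)) with hπ
    have key : ∀ F ⊆ S a, Ex p (I.biUnion S) (fun E => f ((insert a I).filter
        (fun i => A i ((F ∪ E) ∩ S i)))) =
        Ex π I f + (Ex π I (fun E => f (insert a E)) - Ex π I f) * ind (A a F) := by
      intro F hF
      have h1 : ∀ E ⊆ I.biUnion S, (F ∪ E) ∩ S a = F := by
        intro E hE
        have := disjoint_left.1 hd
        ext x
        have h2 := @hE x; have h3 := @hF x; have h4 := @this x
        simp only [mem_inter, mem_union]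
        grind
      have h2 : ∀ E ⊆ I.biUnion S, ∀ i ∈ I, (F ∪ E) ∩ S i = E ∩ S i := by
        intro E hE i hi
        have := disjoint_left.1 (hS a (by simp) i (by simp [hi]) (by rintro rfl; exact ha hi))
        ext x
        have h3 := @hF x; have h4 := @this x
        simp only [mem_inter, mem_union]
        grind
      have h3 : ∀ E ⊆ I.biUnion S, I.filter (fun i => A i ((F ∪ E) ∩ S i)) =
          I.filter (fun i => A i (E ∩ S i)) := by
        intro E hE
        refine filter_congr fun i hi => ?_
        rw [h2 E hE i hi]
      by_cases hA : A a F
      · rw [ind_true hA, mul_one, add_sub_cancel, ← ih']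
        refine Ex_congr fun E hE => ?_
        rw [filter_insert, h1 E hE, if_pos hA, h3 E hE]
      · rw [ind_false hA, mul_zero, add_zero, ← ih']
        refine Ex_congr fun E hE => ?_
        rw [filter_insert, h1 E hE, if_neg hA, h3 E hE]
    rw [Ex_congr key, Ex_add, Ex_const, Ex_mul_left]
    ring

lemma Ex_none {K : Finset β} : Ex p K (fun E => ind (E = ∅)) = ∏ e ∈ K, (1 - p e) := by
  unfold Ex
  rw [sum_eq_single ∅]
  · simp [ind]
  · intro E _ hE; simp [ind, hE]
  · simp

lemma Ex_none_sub {S K : Finset β} (h : S ⊆ K) :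
    Ex p K (fun E => ind (E ∩ S = ∅)) = ∏ e ∈ S, (1 - p e) := by
  rw [← Ex_none, ← Ex_marginal h]

lemma prod_le_exp {S : Finset β} (hp : ∀ e, 0 ≤ p e ∧ p e ≤ 1) {r : ℝ}
    (h : ∀ e ∈ S, 1 - p e ≤ Real.exp (-r)) :
    ∏ e ∈ S, (1 - p e) ≤ Real.exp (-(r * S.card)) := by
  calc _ ≤ ∏ e ∈ S, Real.exp (-r) := prod_le_prod (fun e _ => by linarith [(hp e).2]) h
    _ = _ := by rw [prod_const, ← Real.exp_nat_mul]; ring_nf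

/-- Chernoff lower tail -/
lemma chernoff (hp : ∀ e, 0 ≤ p e ∧ p e ≤ 1) {I : Finset β} {π : ℝ} (hπ : ∀ e ∈ I, π ≤ p e) (m : ℕ) :
    Ex p I (fun E => ind (E.card < m)) ≤ 2 ^ m * Real.exp (-(π * I.card / 2)) := by
  have h1 : Ex p I (fun E => ind (E.card < m)) ≤
      Ex p I (fun E => 2 ^ m * (1/2 : ℝ) ^ E.card) := by
    refine Ex_mono hp fun E _ => ?_
    by_cases h : E.card < m
    · rw [ind_true h, one_div, inv_pow, ← div_eq_mul_inv, one_le_div (by positivity)]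
      exact pow_le_pow_right₀ (by norm_num) h.le
    · rw [ind_false h]; positivity
  refine h1.trans ?_
  rw [Ex_mul_left]
  refine mul_le_mul_of_nonneg_left ?_ (by positivity)
  have h2 : Ex p I (fun E => (1/2 : ℝ) ^ E.card) = ∏ e ∈ I, (p e * (1/2) + (1 - p e)) := by
    unfold Ex
    rw [Finset.prod_add]
    refine sum_congr rfl fun E _ => ?_
    rw [prod_mul_distrib, prod_const]; ring
  rw [h2]
  calc _ ≤ ∏ e ∈ I, Real.exp (-(π/2)) := by
        refine prod_le_prod (fun e _ => by linarith [(hp e).1, (hp e).2]) fun e he => ?_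
        have := Real.add_one_le_exp (-(π/2))
        linarith [hπ e he]
    _ = _ := by rw [prod_const, ← Real.exp_nat_mul]; ring_nf

lemma buckets (hp : ∀ e, 0 ≤ p e ∧ p e ≤ 1) {π : ℝ} (hπ0 : 0 ≤ π) (b m : ℕ) :
    ∀ {I : Finset β}, (∀ e ∈ I, π ≤ p e) → m * b ≤ I.card →
    (1 - Real.exp (-(π * b))) ^ m ≤ Ex p I (fun E => ind (m ≤ E.card)) := by
  have h0 : 0 ≤ 1 - Real.exp (-(π * b)) := by
    have : Real.exp (-(π * b)) ≤ 1 := Real.exp_le_one_iff.2 (by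
      have : 0 ≤ π * b := by positivity
      linarith)
    linarith
  induction m with
  | zero => intro I _ _; simp [ind, Ex_const]
  | succ m ih =>
    intro I hI hc
    obtain ⟨B, hB, hBc⟩ := exists_subset_card_eq (s := I) (n := b) (by nlinarith)
    have ih' := ih (I := I \ B) (fun e he => hI e (Finset.mem_sdiff.1 he).1) (by
      rw [card_sdiff_of_subset hB, hBc]
      have : (m + 1) * b = m * b + b := by ring
      omega)
    rw [Ex_split hB]
    have h1 : Ex p B (fun F => (1 - Real.exp (-(π * b))) ^ m * ind (¬ (F = ∅))) ≤
        Ex p B (fun F => Ex p (I \ B) (fun E => ind (m + 1 ≤ (F ∪ E).card))) := by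
      refine Ex_mono hp fun F hF => ?_
      by_cases hF0 : F = ∅
      · rw [ind_false (by simp [hF0]), mul_zero]
        exact Ex_nonneg hp fun _ _ => ind_nonneg _
      · rw [ind_true hF0, mul_one]
        refine ih'.trans (Ex_mono hp fun E hE => ind_mono fun h => ?_)
        rw [card_union_of_disjoint]
        · have := card_pos.2 (nonempty_iff_ne_empty.2 hF0); omega
        · exact disjoint_of_subset_left hF (disjoint_of_subset_right hE disjoint_sdiff)
    refine le_trans ?_ h1
    rw [Ex_mul_left, pow_succ]
    refine mul_le_mul_of_nonneg_left ?_ (pow_nonneg h0 _)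
    simp only [ind_not]
    have : Ex p B (fun F => 1 - ind (F = ∅)) = 1 - Ex p B (fun F => ind (F = ∅)) := by
      have := Ex_add (p := p) B (fun F => 1 - ind (F = ∅)) (fun F => ind (F = ∅))
      simp only [sub_add_cancel, Ex_const] at this
      linarith
    rw [this, Ex_none]
    have := prod_le_exp (S := B) hp (r := π) (fun e he => by
      have := Real.add_one_le_exp (-π)
      linarith [hI e (hB he)])
    rw [hBc] at this
    linarith

end


inductive Conn {V : Type*} [DecidableEq V] (E : Finset (Bool × Sym2 V)) : Finset V → Prop
  | single (v : V) : Conn E {v}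
  | add (X : Finset V) (w : V) : Conn E X → (∀ c, ∃ u ∈ X, (c, s(u, w)) ∈ E) → Conn E (insert w X)

def Att {V : Type*} (E : Finset (Bool × Sym2 V)) (D : Finset V) (w : V) : Prop :=
  ∀ c, ∃ u ∈ D, (c, s(u, w)) ∈ E

section
variable {V : Type*} [DecidableEq V]

lemma Conn.mono {E E' : Finset (Bool × Sym2 V)} (h : E ⊆ E') {X : Finset V} (hX : Conn E X) :
    Conn E' X := by
  induction hX with
  | single v => exact Conn.single v
  | add X w _ hw ih =>
    exact Conn.add X w ih fun c => by
      obtain ⟨u, hu, hu'⟩ := hw c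
      exact ⟨u, hu, h hu'⟩

lemma Conn.union {E : Finset (Bool × Sym2 V)} {X : Finset V} (hX : Conn E X) (D : Finset V)
    (hD : ∀ w ∈ D, Att E X w) : Conn E (X ∪ D) := by
  induction D using Finset.induction_on with
  | empty => simpa using hX
  | insert w D hw ih =>
    rw [union_insert]
    refine Conn.add _ _ (ih fun w' hw' => hD w' (by simp [hw'])) fun c => ?_
    obtain ⟨u, hu, hu'⟩ := hD w (by simp) c
    exact ⟨u, by simp [hu], hu'⟩

def Fr (Z : Finset V) (K : Finset (Bool × Sym2 V)) (R : Finset V) : Prop :=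
  ∀ c, ∀ u ∈ R, ∀ v ∈ R ∪ Z, u ≠ v → (c, s(u, v)) ∈ K

structure St (Z : Finset V) (H K : Finset (Bool × Sym2 V)) (X D R : Finset V) : Prop where
  conn : Conn H X
  sub : D ⊆ X
  disj : Disjoint X (R ∪ Z)
  disj' : Disjoint R Z
  fr : Fr Z K R
  fr' : ∀ c, ∀ u ∈ D, ∀ v ∈ R ∪ Z, (c, s(u, v)) ∈ K

def Tgt (Z : Finset V) (E : Finset (Bool × Sym2 V)) : Prop := ∃ X, Conn E X ∧ Z ⊆ X

noncomputable def Bad (Z : Finset V) (q : Bool × Sym2 V → ℝ) (K H : Finset (Bool × Sym2 V)) : ℝ :=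
  Ex q K (fun E => ind (¬ Tgt Z (H ∪ E)))

def Qs (D : Finset V) (w : V) : Finset (Bool × Sym2 V) :=
  (univ : Finset Bool) ×ˢ D.image (fun u => s(u, w))

noncomputable def piR (r : Bool → ℝ) (s : ℕ) : ℝ :=
  (1 - Real.exp (-(r true * s))) * (1 - Real.exp (-(r false * s)))

variable {Z : Finset V} {q : Bool × Sym2 V → ℝ} {r : Bool → ℝ}

lemma St.restart {K : Finset (Bool × Sym2 V)} (H) {R : Finset V} (h : Fr Z K R)
    (hd : Disjoint R Z) {v : V} (hv : v ∈ R) : St Z H K {v} {v} (R.erase v) where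
  conn := Conn.single v
  sub := subset_rfl
  disj := by
    have := disjoint_left.1 hd hv
    simp [this]
  disj' := disjoint_of_subset_left (erase_subset _ _) hd
  fr := fun c u hu v' hv' hne => h c u (mem_of_mem_erase hu) v' (by
    simp only [mem_union, mem_erase] at *; tauto) hne
  fr' := fun c u hu v' hv' => by
    rw [mem_singleton] at hu; subst hu
    have h1 := disjoint_left.1 hd hv
    refine h c u hv v' ?_ ?_
    · simp only [mem_union, mem_erase] at *; tauto
    · rintro rfl; simp at hv'; tauto

lemma Bad_nonneg (hq : ∀ e, 0 ≤ q e ∧ q e ≤ 1) (K H) : 0 ≤ Bad Z q K H :=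
  Ex_nonneg hq fun _ _ => ind_nonneg _

lemma Bad_le_one (hq : ∀ e, 0 ≤ q e ∧ q e ≤ 1) (K H) : Bad Z q K H ≤ 1 := by
  have := Ex_mono (p := q) (K := K) hq (f := fun E => ind (¬ Tgt Z (H ∪ E))) (g := fun _ => 1)
    (fun E _ => ind_le_one _)
  rwa [Ex_const] at this

lemma pair_inj {D : Finset V} {w : V} (hw : w ∉ D) :
    Set.InjOn (fun u => s(u, w)) (D : Set V) := by
  intro a ha b hb hab
  simp only [Sym2.eq_iff] at hab
  rcases hab with h | h
  · exact h.1
  · exact absurd ha (by rw [h.1]; exact hw)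

lemma finish (hq : ∀ e, 0 ≤ q e ∧ q e ≤ 1) {H K : Finset (Bool × Sym2 V)} {X D R : Finset V}
    (hK : ∀ b ∈ K, 1 - q b ≤ Real.exp (-r b.1)) (h : St Z H K X D R) :
    Bad Z q K H ≤ ∑ z ∈ Z, ∑ c : Bool, Real.exp (-(r c * D.card)) := by
  have hbound : ∀ E ⊆ K, ind (¬ Tgt Z (H ∪ E)) ≤
      ∑ z ∈ Z, ∑ c : Bool, ind (E ∩ (D.image (fun u => (c, s(u, z)))) = ∅) := by
    intro E hE
    by_cases hT : Tgt Z (H ∪ E)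
    · rw [ind_false (by simpa using hT)]
      exact sum_nonneg fun _ _ => sum_nonneg fun _ _ => ind_nonneg _
    · rw [ind_true hT]
      have : ∃ z ∈ Z, ∃ c : Bool, E ∩ (D.image (fun u => (c, s(u, z)))) = ∅ := by
        by_contra hcon
        push Not at hcon
        apply hT
        refine ⟨X ∪ Z, Conn.union (h.conn.mono subset_union_left) Z ?_, subset_union_right⟩
        intro z hz c
        obtain ⟨b, hb⟩ := hcon z hz c
        simp only [mem_inter, mem_image] at hb
        obtain ⟨hb1, u, hu, rfl⟩ := hb
        exact ⟨u, h.sub hu, mem_union_right _ hb1⟩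
      obtain ⟨z, hz, c, hc⟩ := this
      calc (1:ℝ) = ind (E ∩ (D.image (fun u => (c, s(u, z)))) = ∅) := (ind_true hc).symm
        _ ≤ ∑ c : Bool, ind (E ∩ (D.image (fun u => (c, s(u, z)))) = ∅) :=
          single_le_sum (f := fun c : Bool => ind (E ∩ (D.image (fun u => (c, s(u, z)))) = ∅))
            (fun _ _ => ind_nonneg _) (mem_univ c)
        _ ≤ _ := single_le_sum (f := fun z => ∑ c : Bool, ind (E ∩ (D.image (fun u => (c, s(u, z)))) = ∅))
            (fun _ _ => sum_nonneg fun _ _ => ind_nonneg _) hz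
  refine (Ex_mono hq hbound).trans ?_
  rw [Ex_sum]
  refine sum_le_sum fun z hz => ?_
  rw [Ex_sum]
  refine sum_le_sum fun c _ => ?_
  have hsub : D.image (fun u => (c, s(u, z))) ⊆ K := by
    intro b hb
    obtain ⟨u, hu, rfl⟩ := mem_image.1 hb
    exact h.fr' c u hu z (mem_union_right _ hz)
  rw [Ex_none_sub hsub]
  have hzD : z ∉ D := fun hzD => disjoint_left.1 h.disj (h.sub hzD) (mem_union_right _ hz)
  have hcard : (D.image (fun u => (c, s(u, z)))).card = D.card := by
    refine card_image_of_injOn fun a ha b hb hab => pair_inj hzD ha hb ?_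
    exact (Prod.mk.inj hab).2
  rw [← hcard]
  refine prod_le_exp hq fun e he => ?_
  have := hK e (hsub he)
  obtain ⟨u, hu, rfl⟩ := mem_image.1 he
  exact this

lemma att_prob (hq : ∀ e, 0 ≤ q e ∧ q e ≤ 1) (hr : ∀ c, 0 ≤ r c) {D : Finset V} {w : V} (hw : w ∉ D)
    (hK : ∀ b ∈ Qs D w, 1 - q b ≤ Real.exp (-r b.1)) :
    piR r D.card ≤ Ex q (Qs D w) (fun E => ind (Att E D w)) := by
  set S : Bool → Finset (Bool × Sym2 V) := fun c => D.image (fun u => (c, s(u, w))) with hS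
  have hun : Qs D w = S true ∪ S false := by
    ext ⟨c, e⟩
    cases c <;> simp [Qs, hS]
  have hdis : Disjoint (S true) (S false) := by
    rw [disjoint_left]
    intro b hb hb'
    simp only [hS, mem_image] at hb hb'
    obtain ⟨u, _, rfl⟩ := hb
    obtain ⟨u', _, h⟩ := hb'
    simp at h
  have hSK : ∀ c, S c ⊆ Qs D w := by
    intro c; rw [hun]; cases c
    · exact subset_union_right
    · exact subset_union_left
  have hne : ∀ c, 1 - Real.exp (-(r c * D.card)) ≤ Ex q (S c) (fun E => ind (¬ (E = ∅))) := by
    intro c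
    simp only [ind_not]
    have : Ex q (S c) (fun F => 1 - ind (F = ∅)) = 1 - Ex q (S c) (fun F => ind (F = ∅)) := by
      have := Ex_add (p := q) (S c) (fun F => 1 - ind (F = ∅)) (fun F => ind (F = ∅))
      simp only [sub_add_cancel, Ex_const] at this
      linarith
    rw [this, Ex_none]
    have hcard : (S c).card = D.card := by
      refine card_image_of_injOn fun a ha b hb hab => pair_inj hw ha hb ?_
      exact (Prod.mk.inj hab).2
    have := prod_le_exp (S := S c) hq (r := r c) (fun e he => by
      have := hK e (hSK c he)
      obtain ⟨u, hu, rfl⟩ := mem_image.1 he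
      exact this)
    rw [hcard] at this
    linarith
  have h01 : 0 ≤ 1 - Real.exp (-(r false * D.card)) := by
    have : Real.exp (-(r false * D.card)) ≤ 1 := Real.exp_le_one_iff.2 (by
      have := hr false
      have : 0 ≤ r false * D.card := by positivity
      linarith)
    linarith
  have h02 : 0 ≤ Ex q (S true) (fun E => ind (¬ (E = ∅))) := Ex_nonneg hq fun _ _ => ind_nonneg _
  calc piR r D.card ≤ Ex q (S true) (fun E => ind (¬ (E = ∅))) * Ex q (S false) (fun E => ind (¬ (E = ∅))) :=
        mul_le_mul (hne true) (hne false) h01 h02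
    _ = Ex q (S true) (fun F => Ex q (S false) (fun E => ind (¬ (E = ∅))) * ind (¬ (F = ∅))) := by
        rw [Ex_mul_left, mul_comm]
    _ ≤ _ := by
        rw [hun, Ex_union hdis]
        refine Ex_mono hq fun F hF => ?_
        by_cases hF0 : F = ∅
        · rw [ind_false (by simp [hF0]), mul_zero]
          exact Ex_nonneg hq fun _ _ => ind_nonneg _
        · rw [ind_true hF0, mul_one]
          refine Ex_mono hq fun E hE => ind_mono fun hE0 => ?_
          obtain ⟨b, hb⟩ := nonempty_iff_ne_empty.2 hF0
          obtain ⟨b', hb'⟩ := nonempty_iff_ne_empty.2 hE0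
          obtain ⟨u, hu, hub⟩ := mem_image.1 (hF hb)
          obtain ⟨u', hu', hub'⟩ := mem_image.1 (hE hb')
          subst hub; subst hub'
          intro c
          cases c
          · exact ⟨u', hu', mem_union_right _ hb'⟩
          · exact ⟨u, hu, mem_union_left _ hb⟩

lemma step (hq : ∀ e, 0 ≤ q e ∧ q e ≤ 1) {H K : Finset (Bool × Sym2 V)} {X D R : Finset V}
    (h : St Z H K X D R) (m : ℕ) (a b : ℝ)
    (h1 : ∀ H' K' D', D' ⊆ R → D'.card = m → K' ⊆ K → St Z H' K' (X ∪ D') D' (R \ D') →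
      Bad Z q K' H' ≤ a)
    (h2 : ∀ H' K', K' ⊆ K → Fr Z K' R → Bad Z q K' H' ≤ b) :
    Bad Z q K H ≤ b - (b - a) * Ex (fun w => Ex q (Qs D w) (fun E => ind (Att E D w))) R
      (fun G => ind (m ≤ G.card)) := by
  classical
  have hDR : ∀ u ∈ D, ∀ w ∈ R ∪ Z, u ≠ w := by
    rintro u hu w hw rfl
    exact disjoint_left.1 h.disj (h.sub hu) hw
  set S := R.biUnion (Qs D) with hS
  have hmemS : ∀ b, b ∈ S → ∃ w ∈ R, ∃ u ∈ D, b = (b.1, s(u, w)) := by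
    intro b hb
    simp only [hS, mem_biUnion, Qs, mem_product, mem_image] at hb
    obtain ⟨w, hw, _, u, hu, hh⟩ := hb
    exact ⟨w, hw, u, hu, by rw [hh]⟩
  have hSK : S ⊆ K := by
    intro b hb
    obtain ⟨w, hw, u, hu, hh⟩ := hmemS b hb
    rw [hh]
    exact h.fr' _ u hu w (mem_union_left _ hw)
  have hpair : ∀ u ∈ R, ∀ v ∈ R ∪ Z, u ≠ v → ∀ c, (c, s(u, v)) ∈ K \ S := by
    intro u hu v hv huv c
    rw [Finset.mem_sdiff]
    refine ⟨h.fr c u hu v hv huv, fun hb => ?_⟩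
    obtain ⟨w, hw, u', hu', hh⟩ := hmemS _ hb
    have := (Prod.mk.inj hh).2
    rw [Sym2.eq_iff] at this
    rcases this with hh | hh
    · exact hDR u' hu' u (mem_union_left _ hu) hh.1.symm
    · exact hDR u' hu' v hv hh.2.symm
  have hfr : Fr Z (K \ S) R := fun c u hu v hv huv => hpair u hu v hv huv c
  set G : Finset (Bool × Sym2 V) → Finset V := fun F => R.filter (fun w => Att (F ∩ Qs D w) D w) with hG
  have inner : ∀ F ⊆ S, Ex q (K \ S) (fun E => ind (¬ Tgt Z (H ∪ (F ∪ E)))) ≤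
      b + (-(b - a)) * ind (m ≤ (G F).card) := by
    intro F hF
    have heq : Ex q (K \ S) (fun E => ind (¬ Tgt Z (H ∪ (F ∪ E)))) = Bad Z q (K \ S) (H ∪ F) := by
      unfold Bad; simp only [union_assoc]
    rw [heq]
    by_cases hm : m ≤ (G F).card
    · rw [ind_true hm]
      obtain ⟨D', hD', hc⟩ := exists_subset_card_eq hm
      have hDR' : D' ⊆ R := hD'.trans (filter_subset _ _)
      have := h1 (H ∪ F) (K \ S) D' hDR' hc sdiff_subset
        { conn := by
            refine Conn.union (h.conn.mono subset_union_left) D' fun w hw c => ?_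
            obtain ⟨u, hu, hu'⟩ := (mem_filter.1 (hD' hw)).2 c
            exact ⟨u, h.sub hu, mem_union_right _ (mem_inter.1 hu').1⟩
          sub := subset_union_right
          disj := by
            rw [disjoint_left]
            intro x hx hx'
            have d1 : x ∈ X → x ∉ R ∪ Z := fun hh => disjoint_left.1 h.disj hh
            have d2 : x ∈ R → x ∉ Z := fun hh => disjoint_left.1 h.disj' hh
            have d3 := @hDR' x
            simp only [mem_union, Finset.mem_sdiff] at *
            tauto
          disj' := disjoint_of_subset_left sdiff_subset h.disj'
          fr := fun c u hu v hv huv => hpair u (Finset.mem_sdiff.1 hu).1 v (by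
            simp only [mem_union, Finset.mem_sdiff] at *; tauto) huv c
          fr' := fun c u hu v hv => hpair u (hDR' hu) v (by
            simp only [mem_union, Finset.mem_sdiff] at *; tauto) (by
              rintro rfl
              have d2 := disjoint_left.1 h.disj' (hDR' hu)
              simp only [mem_union, Finset.mem_sdiff] at *; tauto) c }
      linarith
    · rw [ind_false hm]
      have := h2 (H ∪ F) (K \ S) sdiff_subset hfr
      linarith
  have e1 : Bad Z q K H ≤ Ex q S (fun F => b + (-(b - a)) * ind (m ≤ (G F).card)) := by
    unfold Bad
    rw [Ex_split hSK]
    exact Ex_mono hq inner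
  have hpd : ∀ i ∈ R, ∀ i' ∈ R, i ≠ i' → Disjoint (Qs D i) (Qs D i') := by
    intro w hw w' hw' hne
    rw [disjoint_left]
    intro e he he'
    simp only [Qs, mem_product, mem_image] at he he'
    obtain ⟨_, u, hu, h1⟩ := he
    obtain ⟨_, u', hu', h2⟩ := he'
    rw [← h2, Sym2.eq_iff] at h1
    rcases h1 with hh | hh
    · exact hne hh.2
    · exact hDR u hu w' (mem_union_left _ hw') hh.1
  have e2 := Ex_push (p := q) R (Qs D) hpd (fun w E => Att E D w) (fun G => ind (m ≤ G.card))
  rw [Ex_add, Ex_const, Ex_mul_left] at e1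
  rw [← e2]
  have e3 : Ex q S (fun F => ind (m ≤ (G F).card)) = Ex q (R.biUnion (Qs D)) (fun E =>
    ind (m ≤ (filter (fun w => Att (E ∩ Qs D w) D w) R).card)) := rfl
  rw [← e3]
  linarith

lemma attp01 (hq : ∀ e, 0 ≤ q e ∧ q e ≤ 1) (D : Finset V) (w : V) :
    0 ≤ Ex q (Qs D w) (fun E => ind (Att E D w)) ∧ Ex q (Qs D w) (fun E => ind (Att E D w)) ≤ 1 := by
  refine ⟨Ex_nonneg hq fun _ _ => ind_nonneg _, ?_⟩
  have := Ex_mono (p := q) (K := Qs D w) hq (f := fun E => ind (Att E D w)) (g := fun _ => 1)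
    (fun E _ => ind_le_one _)
  rwa [Ex_const] at this

lemma piR_nonneg (hr : ∀ c, 0 ≤ r c) (s : ℕ) : 0 ≤ piR r s := by
  have : ∀ c, 0 ≤ 1 - Real.exp (-(r c * s)) := fun c => by
    have : Real.exp (-(r c * s)) ≤ 1 := Real.exp_le_one_iff.2 (by
      have := hr c
      have : 0 ≤ r c * s := by positivity
      linarith)
    linarith
  exact mul_nonneg (this _) (this _)

lemma St.attp (hq : ∀ e, 0 ≤ q e ∧ q e ≤ 1) (hr : ∀ c, 0 ≤ r c)
    {H K : Finset (Bool × Sym2 V)} {X D R : Finset V}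
    (hK : ∀ b ∈ K, 1 - q b ≤ Real.exp (-r b.1))
    (h : St Z H K X D R) : ∀ w ∈ R, piR r D.card ≤ Ex q (Qs D w) (fun E => ind (Att E D w)) := by
  intro w hw
  refine att_prob hq hr (fun hwD => disjoint_left.1 h.disj (h.sub hwD) (mem_union_left _ hw)) ?_
  intro b hb
  apply hK
  obtain ⟨c, e⟩ := b
  simp only [Qs, mem_product, mem_image] at hb
  obtain ⟨_, u, hu, rfl⟩ := hb
  exact h.fr' c u hu w (mem_union_left _ hw)

lemma step_all (hq : ∀ e, 0 ≤ q e ∧ q e ≤ 1) (hr : ∀ c, 0 ≤ r c)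
    {H K : Finset (Bool × Sym2 V)} {X D R : Finset V}
    (hK : ∀ b ∈ K, 1 - q b ≤ Real.exp (-r b.1))
    (h : St Z H K X D R) (m b' : ℕ) (hb' : m * b' ≤ R.card) (a b P : ℝ) (hab : a ≤ b)
    (hP : P ≤ (1 - Real.exp (-(piR r D.card * b'))) ^ m)
    (h1 : ∀ H' K' D', D' ⊆ R → D'.card = m → K' ⊆ K → St Z H' K' (X ∪ D') D' (R \ D') →
      Bad Z q K' H' ≤ a)
    (h2 : ∀ H' K', K' ⊆ K → Fr Z K' R → Bad Z q K' H' ≤ b) :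
    Bad Z q K H ≤ P * a + (1 - P) * b := by
  have e1 := step hq h m a b h1 h2
  have e2 := buckets (p := fun w => Ex q (Qs D w) (fun E => ind (Att E D w))) (attp01 hq D)
    (piR_nonneg hr D.card) b' m (St.attp hq hr hK h) hb'
  nlinarith

lemma step_half (hq : ∀ e, 0 ≤ q e ∧ q e ≤ 1) (hr : ∀ c, 0 ≤ r c)
    {H K : Finset (Bool × Sym2 V)} {X D R : Finset V}
    (hK : ∀ b ∈ K, 1 - q b ≤ Real.exp (-r b.1))
    (h : St Z H K X D R) (m : ℕ) (a : ℝ) (ha : 0 ≤ a)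
    (h1 : ∀ H' K' D', D' ⊆ R → D'.card = m → K' ⊆ K → St Z H' K' (X ∪ D') D' (R \ D') →
      Bad Z q K' H' ≤ a) :
    Bad Z q K H ≤ a + 2 ^ m * Real.exp (-(piR r D.card * R.card / 2)) := by
  have e1 := step hq h m a 1 h1 (fun H' K' _ _ => Bad_le_one hq _ _)
  have e2 := chernoff (p := fun w => Ex q (Qs D w) (fun E => ind (Att E D w))) (attp01 hq D)
    (St.attp hq hr hK h) m
  set p' := fun w => Ex q (Qs D w) (fun E => ind (Att E D w))
  have e3 : Ex p' R (fun G => ind (G.card < m)) = 1 - Ex p' R (fun G => ind (m ≤ G.card)) := by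
    have := Ex_add (p := p') R (fun F => 1 - ind (m ≤ F.card)) (fun F => ind (m ≤ F.card))
    simp only [sub_add_cancel, Ex_const] at this
    have h4 : Ex p' R (fun G => ind (G.card < m)) = Ex p' R (fun F => 1 - ind (m ≤ F.card)) := by
      refine Ex_congr fun E _ => ?_
      rw [← ind_not, not_le]
    linarith
  have e4 : 0 ≤ Ex p' R (fun G => ind (G.card < m)) := Ex_nonneg (attp01 hq D) fun _ _ => ind_nonneg _
  nlinarith

end


section
variable {V : Type*} [DecidableEq V] {Z : Finset V} {q : Bool × Sym2 V → ℝ} {r : Bool → ℝ}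

lemma stage2 (hq : ∀ e, 0 ≤ q e ∧ q e ≤ 1) (hr : ∀ c, 0 ≤ r c) (Rm l Lam : ℕ) (ε2 ε3 : ℝ)
    (hε2 : 0 ≤ ε2) (hε3 : 0 ≤ ε3)
    (herr : ∀ i, l ≤ i → i < Lam →
      (2:ℝ) ^ (2 ^ (i+1)) * Real.exp (-(piR r (2 ^ i) * Rm / 2)) ≤ ε2)
    (hfin : ∑ z ∈ Z, ∑ c : Bool, Real.exp (-(r c * ((2 ^ Lam : ℕ) : ℝ))) ≤ ε3) :
    ∀ d i, i + d = Lam → l ≤ i → ∀ (H K : Finset (Bool × Sym2 V)) (X D R : Finset V),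
      (∀ b ∈ K, 1 - q b ≤ Real.exp (-r b.1)) → St Z H K X D R → D.card = 2 ^ i →
      Rm + 2 ^ (Lam + 1) ≤ R.card + 2 ^ (i + 1) → Bad Z q K H ≤ d * ε2 + ε3 := by
  intro d
  induction d with
  | zero =>
    intro i hi hl H K X D R hK hSt hD hR
    have := finish hq hK hSt
    rw [hD, show i = Lam by omega] at this
    simpa using this.trans hfin
  | succ d ih =>
    intro i hi hl H K X D R hK hSt hD hR
    have hlt : 2 ^ (i + 1) ≤ 2 ^ (Lam + 1) := Nat.pow_le_pow_right (by norm_num) (by omega)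
    have h := step_half hq hr hK hSt (2 ^ (i+1)) (d * ε2 + ε3) (by positivity) (by
      intro H' K' D' hD' hc hK' hSt'
      refine ih (i+1) (by omega) (by omega) H' K' _ _ _ (fun b hb => hK b (hK' hb)) hSt' hc ?_
      rw [card_sdiff_of_subset hD', hc, pow_succ 2 (i+1)]
      have := card_le_card hD'
      omega)
    rw [hD] at h
    have h2 := herr i hl (by omega)
    have h3 : Real.exp (-(piR r (2 ^ i) * R.card / 2)) ≤ Real.exp (-(piR r (2 ^ i) * Rm / 2)) := by
      apply Real.exp_le_exp.2
      have : (Rm : ℝ) ≤ R.card := by exact_mod_cast (by omega)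
      have := mul_le_mul_of_nonneg_left this (piR_nonneg hr (2 ^ i))
      linarith
    have h4 := mul_le_mul_of_nonneg_left h3 (show (0:ℝ) ≤ 2 ^ (2 ^ (i+1)) by positivity)
    push_cast
    linarith

lemma stage1 (hq : ∀ e, 0 ≤ q e ∧ q e ≤ 1) (hr : ∀ c, 0 ≤ r c) (l ρ : ℕ) (α : ℕ → ℝ) (bb : ℕ → ℕ)
    (g B : ℝ) (hgB : g ≤ B)
    (hα : ∀ i < l, 0 ≤ α i ∧ α i ≤ 1)
    (hbb : ∀ i < l, 2 ^ (i+1) * bb i ≤ ρ)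
    (hP : ∀ i < l, α i ≤ (1 - Real.exp (-(piR r (2 ^ i) * bb i))) ^ (2 ^ (i+1)))
    (hg : ∀ (H K : Finset (Bool × Sym2 V)) (X D R : Finset V),
      (∀ b ∈ K, 1 - q b ≤ Real.exp (-r b.1)) → St Z H K X D R → D.card = 2 ^ l →
      ρ ≤ R.card → Bad Z q K H ≤ g)
    (hB : ∀ (H K : Finset (Bool × Sym2 V)) (R : Finset V),
      (∀ b ∈ K, 1 - q b ≤ Real.exp (-r b.1)) → Fr Z K R → Disjoint R Z →
      ρ ≤ R.card → Bad Z q K H ≤ B) :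
    ∀ d i, i + d = l → ∀ (H K : Finset (Bool × Sym2 V)) (X D R : Finset V),
      (∀ b ∈ K, 1 - q b ≤ Real.exp (-r b.1)) → St Z H K X D R → D.card = 2 ^ i →
      ρ + 2 ^ (l + 1) ≤ R.card + 2 ^ (i + 1) →
      Bad Z q K H ≤ (∏ t ∈ Ico i l, α t) * g + (1 - ∏ t ∈ Ico i l, α t) * B := by
  intro d
  induction d with
  | zero =>
    intro i hi H K X D R hK hSt hD hR
    obtain rfl : i = l := by omega
    simpa using hg H K X D R hK hSt hD (by omega)
  | succ d ih =>
    intro i hi H K X D R hK hSt hD hR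
    have hil : i < l := by omega
    have hlt : 2 ^ (i + 1) ≤ 2 ^ (l + 1) := Nat.pow_le_pow_right (by norm_num) (by omega)
    have hρ : ρ ≤ R.card := by omega
    have hQ0 : 0 ≤ ∏ t ∈ Ico (i+1) l, α t := prod_nonneg fun t ht => (hα t (mem_Ico.1 ht).2).1
    have hle : (∏ t ∈ Ico (i+1) l, α t) * g + (1 - ∏ t ∈ Ico (i+1) l, α t) * B ≤ B := by
      nlinarith
    have h := step_all hq hr hK hSt (2 ^ (i+1)) (bb i) ((hbb i hil).trans hρ)
      _ B (α i) hle (by rw [hD]; exact hP i hil) (by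
      intro H' K' D' hD' hc hK' hSt'
      refine ih (i+1) (by omega) H' K' _ _ _ (fun b hb => hK b (hK' hb)) hSt' hc ?_
      rw [card_sdiff_of_subset hD', hc, pow_succ 2 (i+1)]
      have := card_le_card hD'
      omega)
      (fun H' K' hK' hFr => hB H' K' R (fun b hb => hK b (hK' hb)) hFr hSt.disj' hρ)
    refine h.trans (le_of_eq ?_)
    rw [prod_eq_prod_Ico_succ_bot hil]
    ring

lemma trials (hq : ∀ e, 0 ≤ q e ∧ q e ≤ 1) (hr : ∀ c, 0 ≤ r c) (l ρ : ℕ) (α : ℕ → ℝ) (bb : ℕ → ℕ)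
    (g : ℝ) (hg0 : 0 ≤ g)
    (hα : ∀ i < l, 0 ≤ α i ∧ α i ≤ 1)
    (hbb : ∀ i < l, 2 ^ (i+1) * bb i ≤ ρ)
    (hP : ∀ i < l, α i ≤ (1 - Real.exp (-(piR r (2 ^ i) * bb i))) ^ (2 ^ (i+1)))
    (hg : ∀ (H K : Finset (Bool × Sym2 V)) (X D R : Finset V),
      (∀ b ∈ K, 1 - q b ≤ Real.exp (-r b.1)) → St Z H K X D R → D.card = 2 ^ l →
      ρ ≤ R.card → Bad Z q K H ≤ g) :
    ∀ (t : ℕ) (H K : Finset (Bool × Sym2 V)) (R : Finset V),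
      (∀ b ∈ K, 1 - q b ≤ Real.exp (-r b.1)) → Fr Z K R → Disjoint R Z →
      ρ + t * 2 ^ (l+1) ≤ R.card → Bad Z q K H ≤ g + (1 - ∏ t ∈ Ico 0 l, α t) ^ t := by
  have hQ0 : 0 ≤ ∏ t ∈ Ico 0 l, α t := prod_nonneg fun t ht => (hα t (mem_Ico.1 ht).2).1
  have hQ1 : ∏ t ∈ Ico 0 l, α t ≤ 1 := prod_le_one (fun t ht => (hα t (mem_Ico.1 ht).2).1)
    (fun t ht => (hα t (mem_Ico.1 ht).2).2)
  set Q := ∏ t ∈ Ico 0 l, α t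
  intro t
  induction t with
  | zero =>
    intro H K R hK hF hd hR
    have := Bad_le_one (Z := Z) hq K H
    simp; linarith
  | succ t ih =>
    intro H K R hK hF hd hR
    have hpos : 2 ≤ 2 ^ (l+1) := by
      have : 1 ≤ 2 ^ l := Nat.one_le_two_pow
      rw [pow_succ]; omega
    have hexp : (t+1) * 2 ^ (l+1) = t * 2 ^ (l+1) + 2 ^ (l+1) := by ring
    obtain ⟨v, hv⟩ : R.Nonempty := card_pos.1 (by omega)
    have hpw : 0 ≤ (1 - Q) ^ t := pow_nonneg (by linarith) _
    have h := stage1 (Z := Z) hq hr l (ρ + t * 2 ^ (l+1)) α bb g (g + (1 - Q) ^ t) (by linarith)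
      hα (fun i hi => (hbb i hi).trans (by omega)) hP
      (fun H K X D R hK hSt hD hR => hg H K X D R hK hSt hD (by omega)) ih
      l 0 (by omega) H K _ _ _ hK (St.restart H hF hd hv) (by simp) (by
        rw [card_erase_of_mem hv]; omega)
    refine h.trans ?_
    change Q * g + (1 - Q) * (g + (1 - Q) ^ t) ≤ _
    rw [pow_succ]
    nlinarith

lemma graph_abs (hq : ∀ e, 0 ≤ q e ∧ q e ≤ 1) (hr : ∀ c, 0 ≤ r c) (Rm l Lam T : ℕ) (hl : l ≤ Lam)
    (ε2 ε3 : ℝ) (hε2 : 0 ≤ ε2) (hε3 : 0 ≤ ε3)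
    (herr : ∀ i, l ≤ i → i < Lam →
      (2:ℝ) ^ (2 ^ (i+1)) * Real.exp (-(piR r (2 ^ i) * Rm / 2)) ≤ ε2)
    (hfin : ∑ z ∈ Z, ∑ c : Bool, Real.exp (-(r c * ((2 ^ Lam : ℕ) : ℝ))) ≤ ε3)
    (α : ℕ → ℝ) (bb : ℕ → ℕ)
    (hα : ∀ i < l, 0 ≤ α i ∧ α i ≤ 1)
    (hbb : ∀ i < l, 2 ^ (i+1) * bb i ≤ Rm)
    (hP : ∀ i < l, α i ≤ (1 - Real.exp (-(piR r (2 ^ i) * bb i))) ^ (2 ^ (i+1)))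
    (K : Finset (Bool × Sym2 V)) (R : Finset V)
    (hK : ∀ b ∈ K, 1 - q b ≤ Real.exp (-r b.1)) (hF : Fr Z K R) (hd : Disjoint R Z)
    (hR : Rm + 2 ^ (Lam + 1) + T * 2 ^ (l+1) ≤ R.card) :
    Bad Z q K ∅ ≤ Lam * ε2 + ε3 + (1 - ∏ t ∈ Ico 0 l, α t) ^ T := by
  refine trials hq hr l (Rm + 2 ^ (Lam + 1)) α bb _ (by positivity) hα
    (fun i hi => (hbb i hi).trans (Nat.le_add_right _ _)) hP ?_ T ∅ K R hK hF hd hR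
  intro H K X D R hK hSt hD hR
  have := stage2 hq hr Rm l Lam ε2 ε3 hε2 hε3 herr hfin (Lam - l) l (by omega) le_rfl H K X D R hK hSt hD
    (by omega)
  have h2 : ((Lam - l : ℕ) : ℝ) * ε2 ≤ Lam * ε2 :=
    mul_le_mul_of_nonneg_right (by exact_mod_cast Nat.sub_le _ _) hε2
  linarith

end


lemma one_sub_exp_lb {t : ℝ} (ht : 0 ≤ t) : t / (1 + t) ≤ 1 - Real.exp (-t) := by
  have h1 : Real.exp (-t) ≤ 1 / (1 + t) := by
    rw [Real.exp_neg, ← one_div]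
    exact one_div_le_one_div_of_le (by linarith) (by linarith [Real.add_one_le_exp t])
  have h2 : t / (1 + t) = 1 - 1 / (1 + t) := by field_simp; ring
  linarith

lemma one_sub_exp_lb' {t A : ℝ} (ht : 0 ≤ t) (hA : A ≤ 1) (hAt : A ≤ t) :
    A / 2 ≤ 1 - Real.exp (-t) := by
  refine le_trans ?_ (one_sub_exp_lb ht)
  rw [div_le_div_iff₀ (by norm_num) (by linarith)]
  nlinarith

lemma one_sub_exp_lb1 {t : ℝ} (ht : 1 ≤ t) : 1 / 2 ≤ 1 - Real.exp (-t) :=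
  one_sub_exp_lb' (by linarith) le_rfl ht

lemma pi_lb {r : Bool → ℝ} {s : ℕ} {A : ℝ} (hA0 : 0 ≤ A) (hA : A ≤ 1)
    (h1 : A ≤ r true * s) (h2 : A ≤ r false * s) (h3 : A ≤ (r true * s) * (r false * s)) :
    A / 4 ≤ piR r s := by
  unfold piR
  set x := r true * s
  set y := r false * s
  have hx : 0 ≤ x := by linarith
  have hy : 0 ≤ y := by linarith
  have ex := one_sub_exp_lb' hx hA h1
  have ey := one_sub_exp_lb' hy hA h2
  rcases le_total 1 x with hx1 | hx1
  · have := one_sub_exp_lb1 hx1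
    nlinarith
  · rcases le_total 1 y with hy1 | hy1
    · have := one_sub_exp_lb1 hy1
      nlinarith
    · have ex' := one_sub_exp_lb' hx hx1 le_rfl
      have ey' := one_sub_exp_lb' hy hy1 le_rfl
      calc A / 4 ≤ (x / 2) * (y / 2) := by linarith
        _ ≤ _ := mul_le_mul ex' ey' (by linarith) (by linarith)

lemma sum_exponents (l : ℕ) : ∑ i ∈ range l, (l + 1 - i) * 2 ^ (i + 1) + 2 * l + 6 = 6 * 2 ^ l := by
  induction l with
  | zero => simp
  | succ l ih =>
    rw [sum_range_succ']
    have : ∑ i ∈ range l, (l + 1 + 1 - (i + 1)) * 2 ^ (i + 1 + 1) =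
        2 * ∑ i ∈ range l, (l + 1 - i) * 2 ^ (i + 1) := by
      rw [mul_sum]
      refine sum_congr rfl fun i _ => ?_
      rw [show l + 1 + 1 - (i + 1) = l + 1 - i by omega]; ring
    rw [this, pow_succ]
    simp only [Nat.sub_zero, zero_add, pow_one]
    omega

set_option maxHeartbeats 8000000 in
lemma graph_num (C : ℕ) : ∃ c1 : ℝ, 1 ≤ c1 ∧ ∃ M : ℝ, ∀ (n : ℕ) (y : ℝ), (n : ℝ) = Real.exp y →
    24 ≤ y → M * y ≤ Real.exp (y / 4) →
    ∀ (V : Type) [DecidableEq V] (Z R : Finset V) (K : Finset (Bool × Sym2 V))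
      (q : Bool × Sym2 V → ℝ) (r : Bool → ℝ),
      (∀ e, 0 ≤ q e ∧ q e ≤ 1) → (∀ c, c1 * y / n ≤ r c) → c1 / (n * y) ≤ r true * r false →
      (∀ b ∈ K, 1 - q b ≤ Real.exp (-r b.1)) → Fr Z K R → Disjoint R Z → Z.card ≤ 2 →
      (n : ℝ) / 3 - 2 ≤ R.card → Bad Z q K ∅ ≤ 1 / (n : ℝ) ^ C := by
  obtain ⟨k, hk⟩ : ∃ k : ℝ, k = 2 + 48 * ((C:ℝ) + 2) := ⟨_, rfl⟩
  have hC : (0:ℝ) ≤ C := Nat.cast_nonneg C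
  have hk98 : 98 ≤ k := by linarith
  have hk0 : 0 < k := by linarith
  have hkC : 0 ≤ k * (C + 1) := by positivity
  refine ⟨3072 * k + 256 * k * (C + 1), by linarith, C + 1 + 128 + 64 * k, ?_⟩
  intro n y hny hy hM V _ Z R K q r hq hrc hrr hK hF hd hZ hR
  set c1 := 3072 * k + 256 * k * (C + 1) with hc1
  have hc1a : 3072 * k ≤ c1 := by linarith
  have hc1b : 256 * k * (C + 1) ≤ c1 := by linarith
  clear_value c1
  have hc10 : 0 < c1 := by linarith
  -- basic exponentials
  set E4 := Real.exp (y / 4) with hE4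
  have hCy : 0 ≤ C * y := mul_nonneg hC (by linarith)
  have hky : 98 * y ≤ k * y := mul_le_mul_of_nonneg_right hk98 (by linarith)
  have hky2 : k * 24 ≤ k * y := mul_le_mul_of_nonneg_left hy hk0.le
  have hc1y : c1 * 24 ≤ c1 * y := mul_le_mul_of_nonneg_left hy hc10.le
  have hE4y : (C + 1) * y ≤ E4 := by linarith
  have hE4a : (128 + 64 * k) * y ≤ E4 := by linarith
  have hE1 : 1 ≤ E4 := by linarith
  have hn4 : (n : ℝ) = E4 ^ 4 := by
    rw [hny, hE4, ← Real.exp_nat_mul]; congr 1; push_cast; ring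
  have hnE : E4 ≤ n := by rw [hn4]; exact le_self_pow₀ hE1 (by norm_num)
  have hnE2 : E4 ^ 2 * E4 ^ 2 = n := by rw [hn4]; ring
  have hE2 : E4 ≤ E4 ^ 2 := le_self_pow₀ hE1 (by norm_num)
  have hn0 : (0:ℝ) < n := by linarith
  have hy0 : 0 < y := by linarith
  have hr : ∀ c, 0 ≤ r c := fun c => le_trans (by positivity) (hrc c)
  -- choice of l and Lam
  obtain ⟨l, hl1, hl2⟩ := exists_nat_pow_near (x := y / 24) (y := (2:ℝ)) (by linarith) (by norm_num)
  have hδ : 64 * k ≤ n := by linarith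
  obtain ⟨Lam, hL1, hL2⟩ := exists_nat_pow_near (x := n / (64 * k)) (y := (2:ℝ))
    (by rw [le_div_iff₀ (by positivity)]; linarith) (by norm_num)
  rw [le_div_iff₀ (by positivity)] at hL1
  rw [div_lt_iff₀ (by positivity)] at hL2
  have hlL : l ≤ Lam := by
    by_contra hcon
    push Not at hcon
    have h1 : (2:ℝ) ^ (Lam + 1) ≤ 2 ^ l := pow_le_pow_right₀ (by norm_num) hcon
    have : (2:ℝ) ^ (Lam + 1) * (64 * k) ≤ y / 24 * (64 * k) :=
      mul_le_mul_of_nonneg_right (h1.trans hl1) (by positivity)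
    linarith
  obtain ⟨Rm, hRm⟩ : ∃ Rm : ℕ, Rm = ⌈(n:ℝ) / 8⌉₊ := ⟨_, rfl⟩
  have hRm1 : (n:ℝ) / 8 ≤ Rm := by rw [hRm]; exact Nat.le_ceil _
  have hRm2 : (Rm:ℝ) < n / 8 + 1 := by rw [hRm]; exact Nat.ceil_lt_add_one (by positivity)
  obtain ⟨T, hT⟩ : ∃ T : ℕ, T = ⌈E4 ^ 2⌉₊ := ⟨_, rfl⟩
  have hT1 : E4 ^ 2 ≤ T := by rw [hT]; exact Nat.le_ceil _
  have hT2 : (T:ℝ) < E4 ^ 2 + 1 := by rw [hT]; exact Nat.ceil_lt_add_one (by positivity)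
  set α : ℕ → ℝ := fun i => (1/2 : ℝ) ^ ((l + 1 - i) * 2 ^ (i + 1)) with hα
  have hs_gen : ∀ i, l ≤ i → y ≤ 48 * (2:ℝ) ^ i := by
    intro i hi
    have : (2:ℝ) ^ l ≤ 2 ^ i := pow_le_pow_right₀ (by norm_num) hi
    rw [pow_succ] at hl2
    linarith
  -- lower bounds on r s
  have hrs : ∀ (s : ℝ) (c : Bool), 0 ≤ s → c1 * y * s / n ≤ r c * s := by
    intro s c hs
    have := mul_le_mul_of_nonneg_right (hrc c) hs
    calc c1 * y * s / n = c1 * y / n * s := by ring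
      _ ≤ _ := this
  have hrrs : ∀ (s : ℝ), c1 * s ^ 2 / (n * y) ≤ (r true * s) * (r false * s) := by
    intro s
    have := mul_le_mul_of_nonneg_right hrr (sq_nonneg s)
    calc c1 * s ^ 2 / (n * y) = c1 / (n * y) * s ^ 2 := by ring
      _ ≤ _ := this
      _ = _ := by ring
  have hfinal := graph_abs (Z := Z) hq hr Rm l Lam T hlL (Real.exp (-((C + 2) * y)))
    (4 * Real.exp (-((C + 1) * y))) (by positivity) (by positivity) ?_ ?_ α
    (fun i => Rm / 2 ^ (i+1)) ?_ ?_ ?_ K R hK hF hd ?_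
  · -- final numerics
    refine hfinal.trans ?_
    have hlam : (Lam : ℝ) ≤ n := by
      have h1 : (Lam:ℝ) < 2 ^ Lam := by exact_mod_cast Nat.lt_two_pow_self
      have : (2:ℝ) ^ Lam ≤ 2 ^ Lam * (64 * k) :=
        le_mul_of_one_le_right (by positivity) (by linarith)
      linarith
    have hprod : Real.exp (-(y / 4)) ≤ ∏ t ∈ Ico 0 l, α t := by
      rw [hα, ← range_eq_Ico, prod_pow_eq_pow_sum]
      have hs := sum_exponents l
      set Sm := ∑ i ∈ range l, (l + 1 - i) * 2 ^ (i + 1)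
      have hSm : (Sm : ℝ) ≤ 6 * 2 ^ l := by
        have : Sm ≤ 6 * 2 ^ l := by omega
        exact_mod_cast this
      have h12 : Real.exp (-1) ≤ 1/2 := by linarith [one_sub_exp_lb1 (t := 1) le_rfl]
      calc Real.exp (-(y/4)) ≤ Real.exp (Sm * (-1)) := Real.exp_le_exp.2 (by linarith)
        _ = Real.exp (-1) ^ Sm := Real.exp_nat_mul _ _
        _ ≤ _ := pow_le_pow_left₀ (Real.exp_pos _).le h12 _
    have hα01 : ∏ t ∈ Ico 0 l, α t ≤ 1 :=
      prod_le_one (fun t _ => by simp only [hα]; positivity)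
        (fun t _ => pow_le_one₀ (by norm_num) (by norm_num))
    set Q := ∏ t ∈ Ico 0 l, α t
    have hQT : (1 - Q) ^ T ≤ Real.exp (-((C + 1) * y)) := by
      calc (1 - Q) ^ T ≤ Real.exp (-Q) ^ T :=
            pow_le_pow_left₀ (by linarith) (by linarith [Real.add_one_le_exp (-Q)]) _
        _ = Real.exp (T * (-Q)) := (Real.exp_nat_mul _ _).symm
        _ ≤ _ := by
          apply Real.exp_le_exp.2
          have h1 : E4 ≤ T * Q := by
            have h3 : E4 = E4 ^ 2 * Real.exp (-(y/4)) := by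
              rw [hE4, ← Real.exp_nat_mul, ← Real.exp_add]; congr 1; push_cast; ring
            rw [h3]
            exact mul_le_mul hT1 hprod (Real.exp_pos _).le (by positivity)
          linarith
    have e1 : Real.exp (-((C + 2) * y)) = Real.exp (-((C + 1) * y)) * (1 / n) := by
      rw [hny, one_div, ← Real.exp_neg, ← Real.exp_add]; congr 1; ring
    have e2 : Real.exp (-((C + 1) * y)) = 1 / (n:ℝ) ^ C * (1 / n) := by
      rw [hny, one_div, one_div, ← Real.exp_nat_mul, ← Real.exp_neg, ← Real.exp_neg, ← Real.exp_add]
      congr 1; ring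
    have e3 : (Lam : ℝ) * Real.exp (-((C + 2) * y)) ≤ Real.exp (-((C + 1) * y)) := by
      rw [e1]
      have : (Lam : ℝ) * (1 / n) ≤ 1 := by rw [mul_one_div, div_le_one hn0]; exact hlam
      have h4 := Real.exp_pos (-((C + 1) * y))
      calc _ = Real.exp (-((C + 1) * y)) * ((Lam : ℝ) * (1 / n)) := by ring
        _ ≤ _ := mul_le_of_le_one_right h4.le this
    have e4 : 6 * Real.exp (-((C + 1) * y)) ≤ 1 / (n:ℝ) ^ C := by
      rw [e2]
      have : 6 * (1 / (n:ℝ)) ≤ 1 := by rw [mul_one_div, div_le_one hn0]; linarith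
      have h4 : 0 < 1 / (n:ℝ) ^ C := by positivity
      calc _ = 1 / (n:ℝ) ^ C * (6 * (1 / (n:ℝ))) := by ring
        _ ≤ _ := mul_le_of_le_one_right h4.le this
    linarith
  · -- herr
    intro i hi hiL
    have hs := hs_gen i hi
    set s : ℝ := 2 ^ i with hsdef
    have hs0 : 0 < s := by positivity
    have hsL : s * (64 * k) ≤ n := by
      have : s ≤ 2 ^ Lam := pow_le_pow_right₀ (by norm_num) hiL.le
      exact (mul_le_mul_of_nonneg_right this (by positivity)).trans hL1
    have hp : 64 * k * s / n / 4 ≤ piR r (2 ^ i) := by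
      have key : 64 * k * s / n ≤ c1 * y * s / n := by
        apply div_le_div_of_nonneg_right _ hn0.le
        apply mul_le_mul_of_nonneg_right _ hs0.le
        linarith
      have hcast : ((2 ^ i : ℕ) : ℝ) = s := by push_cast; rfl
      refine pi_lb (by positivity) ?_ ?_ ?_ ?_
      · rw [div_le_one hn0]; linarith
      · rw [hcast]; exact key.trans (hrs s true hs0.le)
      · rw [hcast]; exact key.trans (hrs s false hs0.le)
      · rw [hcast]
        refine le_trans ?_ (hrrs s)
        rw [div_le_div_iff₀ hn0 (by positivity)]
        have : 64 * k * y ≤ c1 * s := by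
          have g1 := mul_le_mul_of_nonneg_left hs hk0.le
          have g2 := mul_le_mul_of_nonneg_right hc1a hs0.le
          linarith
        have h5 : 0 ≤ s * n := by positivity
        have h6 := mul_le_mul_of_nonneg_left this h5
        linarith
    have hp2 : k * s ≤ piR r (2 ^ i) * Rm / 2 := by
      have : 64 * k * s / n / 4 * (n / 8) ≤ piR r (2 ^ i) * Rm :=
        mul_le_mul hp hRm1 (by positivity) (piR_nonneg hr _)
      have h6 : 64 * k * s / n / 4 * (n / 8) = 2 * (k * s) := by field_simp; ring
      linarith
    have h2e : (2:ℝ) ≤ Real.exp 1 := by linarith [Real.add_one_le_exp (1:ℝ)]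
    calc (2:ℝ) ^ (2 ^ (i+1)) * Real.exp (-(piR r (2 ^ i) * Rm / 2))
        ≤ Real.exp 1 ^ (2 ^ (i+1)) * Real.exp (-(k * s)) :=
          mul_le_mul (pow_le_pow_left₀ (by norm_num) h2e _) (Real.exp_le_exp.2 (by linarith))
            (Real.exp_pos _).le (by positivity)
      _ = Real.exp (2 * s - k * s) := by
          rw [← Real.exp_nat_mul, ← Real.exp_add]; congr 1; push_cast; rw [hsdef]; ring
      _ ≤ _ := by
          apply Real.exp_le_exp.2
          rw [hk]
          have g1 := mul_le_mul_of_nonneg_left hs (show (0:ℝ) ≤ C + 2 by linarith)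
          linarith
  · -- hfin
    have hb : ∀ c, Real.exp (-(r c * ((2 ^ Lam : ℕ) : ℝ))) ≤ Real.exp (-((C + 1) * y)) := by
      intro c
      apply Real.exp_le_exp.2
      have h1 := hrs ((2:ℝ) ^ Lam) c (by positivity)
      rw [pow_succ] at hL2
      have h2 : (C + 1) * y ≤ c1 * y * 2 ^ Lam / n := by
        rw [le_div_iff₀ hn0]
        have h7 : (n:ℝ) ≤ 128 * k * 2 ^ Lam := by linarith
        have h8 : (C + 1) * (128 * k) ≤ c1 := by linarith
        have h9 : 0 ≤ (C + 1) * y := by positivity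
        have h10 : 0 ≤ y * 2 ^ Lam := by positivity
        calc (C + 1) * y * n ≤ (C + 1) * y * (128 * k * 2 ^ Lam) := mul_le_mul_of_nonneg_left h7 h9
          _ = ((C + 1) * (128 * k)) * (y * 2 ^ Lam) := by ring
          _ ≤ c1 * (y * 2 ^ Lam) := mul_le_mul_of_nonneg_right h8 h10
          _ = _ := by ring
      push_cast
      linarith
    calc ∑ z ∈ Z, ∑ c : Bool, Real.exp (-(r c * ((2 ^ Lam : ℕ) : ℝ)))
        ≤ ∑ z ∈ Z, ∑ c : Bool, Real.exp (-((C + 1) * y)) :=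
          sum_le_sum fun _ _ => sum_le_sum fun c _ => hb c
      _ = Z.card * (2 * Real.exp (-((C + 1) * y))) := by simp
      _ ≤ _ := by
        have : (Z.card : ℝ) ≤ 2 := by exact_mod_cast hZ
        have h4 := Real.exp_pos (-((C + 1) * y))
        have h5 := mul_le_mul_of_nonneg_right this h4.le
        linarith
  · intro i hi
    exact ⟨by simp only [hα]; positivity, pow_le_one₀ (by norm_num) (by norm_num)⟩
  · intro i hi
    exact Nat.mul_div_le _ _
  · intro i hi
    set s : ℝ := 2 ^ i with hsdef
    have hs0 : 0 < s := by positivity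
    have hsl : s ≤ 2 ^ l := pow_le_pow_right₀ (by norm_num) hi.le
    have hyl := hs_gen l le_rfl
    set τ : ℝ := s / 2 ^ l with hτ
    have hτ0 : 0 < τ := by positivity
    have hτ1 : τ ≤ 1 := by rw [hτ, div_le_one (by positivity)]; exact hsl
    have h128 : 128 * s ≤ n := by linarith
    have hb : (n:ℝ) / (32 * s) ≤ ((Rm / 2 ^ (i+1) : ℕ) : ℝ) := by
      have h1 : Rm < (Rm / 2 ^ (i+1) + 1) * 2 ^ (i+1) := by
        have := Nat.lt_div_mul_add (a := Rm) (b := 2 ^ (i+1)) (by positivity)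
        linarith
      generalize Rm / 2 ^ (i+1) = w at h1 ⊢
      have h2 : (Rm:ℝ) < ((w : ℝ) + 1) * 2 ^ (i+1) := by exact_mod_cast h1
      rw [pow_succ, ← hsdef] at h2
      rw [div_le_iff₀ (by positivity)]
      linarith
    have hp : 128 * s * τ / n / 4 ≤ piR r (2 ^ i) := by
      have key : 128 * s * τ / n ≤ c1 * y * s / n := by
        apply div_le_div_of_nonneg_right _ hn0.le
        have : 128 * τ ≤ c1 * y := by linarith
        have h9 := mul_le_mul_of_nonneg_right this hs0.le
        linarith
      have hcast : ((2 ^ i : ℕ) : ℝ) = s := by push_cast; rfl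
      refine pi_lb (by positivity) ?_ ?_ ?_ ?_
      · rw [div_le_one hn0]
        have h9 := mul_le_of_le_one_right hs0.le hτ1
        linarith
      · rw [hcast]; exact key.trans (hrs s true hs0.le)
      · rw [hcast]; exact key.trans (hrs s false hs0.le)
      · rw [hcast]
        refine le_trans ?_ (hrrs s)
        rw [div_le_div_iff₀ hn0 (by positivity)]
        have hτs : τ * 2 ^ l = s := by rw [hτ]; field_simp
        have h1 : 128 * y ≤ c1 * 2 ^ l := by
          have : 6144 * (2:ℝ) ^ l ≤ c1 * 2 ^ l :=
            mul_le_mul_of_nonneg_right (by linarith) (by positivity)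
          linarith
        have h2 : 128 * y * τ ≤ c1 * s := by
          calc 128 * y * τ ≤ c1 * 2 ^ l * τ := mul_le_mul_of_nonneg_right h1 hτ0.le
            _ = c1 * s := by rw [← hτs]; ring
        have h5 : 0 ≤ s * n := by positivity
        have h6 := mul_le_mul_of_nonneg_left h2 h5
        linarith
    have hp2 : τ ≤ piR r (2 ^ i) * ((Rm / 2 ^ (i+1) : ℕ) : ℝ) := by
      have : 128 * s * τ / n / 4 * (n / (32 * s)) ≤ piR r (2 ^ i) * ((Rm / 2 ^ (i+1) : ℕ) : ℝ) :=
        mul_le_mul hp hb (by positivity) (piR_nonneg hr _)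
      have h6 : 128 * s * τ / n / 4 * (n / (32 * s)) = τ := by field_simp; norm_num
      linarith
    have h7 := one_sub_exp_lb' (t := piR r (2 ^ i) * ((Rm / 2 ^ (i+1) : ℕ) : ℝ)) (A := τ)
      (by linarith) hτ1 hp2
    have h8 : α i = (τ / 2) ^ (2 ^ (i+1)) := by
      simp only [hα]
      rw [pow_mul]
      congr 1
      rw [hτ, hsdef, one_div, inv_pow, div_div, inv_eq_one_div,
        div_eq_div_iff (by positivity) (by positivity), one_mul, ← pow_succ, ← pow_add]
      congr 1; omega
    rw [h8]
    exact pow_le_pow_left₀ (by positivity) h7 _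
  · -- card
    have h1 : (2:ℝ) ^ (Lam + 1) ≤ n / 24 := by
      rw [pow_succ]
      have : (2:ℝ) ^ Lam * 98 ≤ 2 ^ Lam * k := mul_le_mul_of_nonneg_left hk98 (by positivity)
      linarith
    have h2 : (T:ℝ) * 2 ^ (l+1) ≤ n / 12 := by
      have h3 : (2:ℝ) ^ (l+1) ≤ E4 ^ 2 / 24 := by
        rw [pow_succ]
        linarith
      have h4 : (T:ℝ) ≤ 2 * E4 ^ 2 := by linarith
      calc (T:ℝ) * 2 ^ (l+1) ≤ (2 * E4 ^ 2) * (E4 ^ 2 / 24) :=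
            mul_le_mul h4 h3 (by positivity) (by positivity)
        _ = n / 12 := by rw [← hnE2]; ring
    have h3 : (Rm + 2 ^ (Lam + 1) + T * 2 ^ (l+1) : ℝ) ≤ R.card := by
      have : (72:ℝ) ≤ n := by linarith
      linarith
    exact_mod_cast h3


section
variable {V : Type*} [DecidableEq V]

structure PInv (J0 : Finset (Finset V)) (P : Finset (Finset (Finset V))) : Prop where
  sub : ∀ C ∈ P, C ⊆ J0
  ne : ∀ C ∈ P, C.Nonempty
  cov : ∀ J ∈ J0, ∃ C ∈ P, J ∈ C
  eq : ∀ C ∈ P, ∀ C' ∈ P, ∀ J, J ∈ C → J ∈ C' → C = C'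

lemma PInv.init (J0 : Finset (Finset V)) :
    PInv J0 (J0.image fun J => ({J} : Finset (Finset V))) where
  sub := by simp
  ne := by simp
  cov := by simp
  eq := by
    intro C hC C' hC' J hJ hJ'
    simp only [mem_image] at hC hC'
    obtain ⟨a, _, rfl⟩ := hC
    obtain ⟨b, _, rfl⟩ := hC'
    simp only [mem_singleton] at hJ hJ'
    rw [← hJ, ← hJ']

lemma PInv.step {E1 E2 J0 : Finset (Finset V)} {P P' : Finset (Finset (Finset V))}
    (h : PInv J0 P) (hs : MergeStep E1 E2 P P') : PInv J0 P' ∧ P'.card < P.card := by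
  obtain ⟨C, hC, C', hC', hne, -, rfl⟩ := hs
  refine ⟨⟨?_, ?_, ?_, ?_⟩, ?_⟩
  · intro D hD
    simp only [mem_insert, mem_erase] at hD
    rcases hD with rfl | hD
    · exact union_subset (h.sub _ hC) (h.sub _ hC')
    · exact h.sub _ hD.2.2
  · intro D hD
    simp only [mem_insert, mem_erase] at hD
    rcases hD with rfl | hD
    · exact (h.ne _ hC).mono subset_union_left
    · exact h.ne _ hD.2.2
  · intro J hJ
    obtain ⟨D, hD, hJD⟩ := h.cov J hJ
    by_cases h1 : D = C
    · exact ⟨C ∪ C', by simp, by subst h1; simp [hJD]⟩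
    by_cases h2 : D = C'
    · exact ⟨C ∪ C', by simp, by subst h2; simp [hJD]⟩
    exact ⟨D, by simp [h1, h2, hD], hJD⟩
  · have key : ∀ D ∈ (P.erase C).erase C', ∀ J, J ∈ C ∪ C' → J ∈ D → False := by
      intro D hD J hJ hJD
      simp only [mem_erase, mem_union] at hD hJ
      rcases hJ with hJ | hJ
      · exact hD.2.1 (h.eq _ hD.2.2 _ hC J hJD hJ)
      · exact hD.1 (h.eq _ hD.2.2 _ hC' J hJD hJ)
    intro D hD D' hD' J hJ hJ'
    rcases mem_insert.1 hD with rfl | hD1 <;> rcases mem_insert.1 hD' with rfl | hD1'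
    · rfl
    · exact (key _ hD1' J hJ hJ').elim
    · exact (key _ hD1 J hJ' hJ).elim
    · simp only [mem_erase] at hD1 hD1'
      exact h.eq _ hD1.2.2 _ hD1'.2.2 J hJ hJ'
  · have h1 := card_insert_le (C ∪ C') ((P.erase C).erase C')
    have h2 := card_erase_add_one (mem_erase.2 ⟨hne.symm, hC'⟩)
    have h3 := card_erase_add_one hC
    omega

lemma PInv.terminal {E1 E2 J0 : Finset (Finset V)} : ∀ (m : ℕ) (P : Finset (Finset (Finset V))),
    P.card = m → PInv J0 P →
    ∃ P', Relation.ReflTransGen (MergeStep E1 E2) P P' ∧ PInv J0 P' ∧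
      ∀ C ∈ P', ∀ C' ∈ P', Mergeable E1 E2 C C' → C = C' := by
  intro m
  induction m using Nat.strong_induction_on with
  | _ m ih =>
    intro P hm hP
    by_cases hex : ∃ P', MergeStep E1 E2 P P'
    · obtain ⟨P', hP'⟩ := hex
      obtain ⟨h1, h2⟩ := hP.step hP'
      obtain ⟨Q, hQ, hQ'⟩ := ih P'.card (hm ▸ h2) P' rfl h1
      exact ⟨Q, Relation.ReflTransGen.head hP' hQ, hQ'⟩
    · refine ⟨P, Relation.ReflTransGen.refl, hP, ?_⟩
      intro C hC C' hC' hM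
      by_contra hne
      exact hex ⟨_, C, hC, C', hC', hne, hM, rfl⟩

def Compat (A : Finset V) (E1 E2 : Finset (Finset V)) (G : Finset (Bool × Sym2 V)) : Prop :=
  ∀ c u w, (c, s(u, w)) ∈ G → ∃ e ∈ (bif c then E1 else E2), insert u A ∪ insert w A ⊆ e

def Same (P : Finset (Finset (Finset V))) (J J' : Finset V) : Prop := ∃ C ∈ P, J ∈ C ∧ J' ∈ C

lemma conn_same {E1 E2 J0 : Finset (Finset V)} {P : Finset (Finset (Finset V))}
    (hP : PInv J0 P) (hT : ∀ C ∈ P, ∀ C' ∈ P, Mergeable E1 E2 C C' → C = C')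
    {A : Finset V} {G : Finset (Bool × Sym2 V)} (hG : Compat A E1 E2 G)
    {X : Finset V} (hX : Conn G X) (hXJ : ∀ u ∈ X, insert u A ∈ J0) :
    ∀ u ∈ X, ∀ v ∈ X, Same P (insert u A) (insert v A) := by
  induction hX with
  | single v =>
    intro u hu v' hv'
    rw [mem_singleton] at hu hv'
    subst hu; subst hv'
    obtain ⟨C, hC, hC'⟩ := hP.cov _ (hXJ v' (by simp))
    exact ⟨C, hC, hC', hC'⟩
  | add X w _ hw ih =>
    have ih := ih fun u hu => hXJ u (by simp [hu])
    obtain ⟨u1, hu1, hg1⟩ := hw true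
    obtain ⟨u2, hu2, hg2⟩ := hw false
    obtain ⟨C, hC, h1, h2⟩ := ih u1 hu1 u2 hu2
    obtain ⟨C', hC', hw'⟩ := hP.cov _ (hXJ w (by simp))
    have hCC : C = C' := by
      refine hT C hC C' hC' ⟨⟨_, h1, _, hw', ?_⟩, ⟨_, h2, _, hw', ?_⟩⟩
      · simpa using hG _ _ _ hg1
      · simpa using hG _ _ _ hg2
    subst hCC
    have hall : ∀ u ∈ insert w X, insert u A ∈ C := by
      intro u hu
      rcases mem_insert.1 hu with rfl | hu
      · exact hw'
      · obtain ⟨D, hD, a, b⟩ := ih u1 hu1 u hu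
        rwa [hP.eq _ hC _ hD _ h1 a]
    intro u hu v hv
    exact ⟨C, hC, hall u hu, hall v hv⟩

lemma conn_avoid {A : Finset V} {G : Finset (Bool × Sym2 V)}
    (hG : ∀ c u w, (c, s(u, w)) ∈ G → u ∉ A ∧ w ∉ A) {X : Finset V} (hX : Conn G X)
    (hx : ∃ x ∈ X, x ∉ A) : ∀ u ∈ X, u ∉ A := by
  induction hX with
  | single v =>
    obtain ⟨x, hx, hxA⟩ := hx
    intro u hu
    rw [mem_singleton] at hu hx
    rwa [hu, ← hx]
  | add X w _ hw ih =>
    obtain ⟨u1, hu1, hg1⟩ := hw true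
    have h1 := hG _ _ _ hg1
    intro u hu
    rcases mem_insert.1 hu with rfl | hu
    · exact h1.2
    · exact ih ⟨u1, hu1, h1.1⟩ u hu

lemma jperc_of [Fintype V] {j : ℕ} (hj : 1 ≤ j) (hn : j ≤ Fintype.card V)
    {E1 E2 : Finset (Finset V)}
    (h : ∀ A : Finset V, A.card = j - 1 → ∀ x y, x ∉ A → y ∉ A → x ≠ y →
      ∃ G : Finset (Bool × Sym2 V), Compat A E1 E2 G ∧
        ∃ X, Conn G X ∧ ({x, y} : Finset V) ⊆ X ∧ ∀ u ∈ X, u ∉ A) :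
    JPercolates j E1 E2 := by
  unfold JPercolates PercolatesOn
  set J0 := (univ : Finset V).powersetCard j with hJ0
  obtain ⟨P, hreach, hP, hT⟩ := PInv.terminal (E1 := E1) (E2 := E2) _ _ rfl (PInv.init J0)
  have hmem : ∀ J, J ∈ J0 ↔ J.card = j := by intro J; simp [hJ0]
  have hsame : ∀ (d : ℕ) (J J' : Finset V), J ∈ J0 → J' ∈ J0 → (J' \ J).card = d → Same P J J' := by
    intro d
    induction d with
    | zero =>
      intro J J' hJ hJ' hd
      rw [card_eq_zero, sdiff_eq_empty_iff_subset] at hd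
      have := eq_of_subset_of_card_le hd (by rw [(hmem _).1 hJ, (hmem _).1 hJ'])
      subst this
      obtain ⟨C, hC, hC'⟩ := hP.cov _ hJ
      exact ⟨C, hC, hC', hC'⟩
    | succ d ih =>
      intro J J' hJ hJ' hd
      have hcJ := (hmem _).1 hJ
      have hcJ' := (hmem _).1 hJ'
      have hd2 : (J \ J').card = d + 1 := by
        have a1 := card_sdiff_add_card_inter J J'
        have a2 := card_sdiff_add_card_inter J' J
        rw [inter_comm] at a2
        omega
      obtain ⟨y, hy⟩ := card_pos.1 (by omega : 0 < (J' \ J).card)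
      obtain ⟨x, hx⟩ := card_pos.1 (by omega : 0 < (J \ J').card)
      rw [Finset.mem_sdiff] at hx hy
      have hxy : x ≠ y := by rintro rfl; exact hx.2 hy.1
      have hAc : (J.erase x).card = j - 1 := by rw [card_erase_of_mem hx.1, hcJ]
      have hyA : y ∉ J.erase x := fun hh => hy.2 (mem_of_mem_erase hh)
      obtain ⟨G, hG, X, hX, hxyX, hXA⟩ := h (J.erase x) hAc x y (by simp) hyA hxy
      have hS := conn_same hP hT hG hX (fun u hu => by
        rw [hmem, card_insert_of_notMem (hXA u hu), hAc]; omega)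
        x (hxyX (by simp)) y (hxyX (by simp))
      rw [insert_erase hx.1] at hS
      obtain ⟨C, hC, c1, c2⟩ := hS
      have hJ1 : insert y (J.erase x) ∈ J0 := hP.sub _ hC c2
      have hd3 : (J' \ insert y (J.erase x)).card = d := by
        have : J' \ insert y (J.erase x) = (J' \ J).erase y := by
          ext a
          simp only [Finset.mem_sdiff, mem_insert, mem_erase]
          have : a ∈ J' → a ≠ x := by rintro h1 rfl; exact hx.2 h1
          tauto
        rw [this, card_erase_of_mem (by rw [Finset.mem_sdiff]; exact hy), hd]; rfl
      obtain ⟨D, hD, d1, d2⟩ := ih _ _ hJ1 hJ' hd3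
      have := hP.eq _ hC _ hD _ c2 d1
      subst this
      exact ⟨C, hC, c1, d2⟩
  have hne : J0.Nonempty := by
    rw [hJ0]; exact powersetCard_nonempty.2 (by simpa using hn)
  obtain ⟨J, hJ⟩ := hne
  obtain ⟨C, hC, hJC⟩ := hP.cov J hJ
  have hCJ : C = J0 := by
    refine Subset.antisymm (hP.sub _ hC) fun J' hJ' => ?_
    obtain ⟨D, hD, d1, d2⟩ := hsame _ J J' hJ hJ' rfl
    rwa [hP.eq _ hC _ hD _ hJC d1]
  have hPe : P = {J0} := by
    ext D
    rw [mem_singleton]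
    constructor
    · intro hD
      obtain ⟨J', hJ'⟩ := hP.ne _ hD
      rw [← hCJ]
      exact hP.eq _ hD _ hC J' hJ' (hCJ ▸ hP.sub _ hD hJ')
    · rintro rfl; exact hCJ ▸ hC
  rwa [hPe] at hreach
end


lemma Ex_map {α β : Type*} [DecidableEq α] [DecidableEq β] (p : β → ℝ) (φ : α ↪ β) (K : Finset α)
    (g : Finset β → ℝ) : Ex p (K.map φ) g = Ex (fun a => p (φ a)) K (fun E => g (E.map φ)) := by
  induction K using Finset.induction_on generalizing g with
  | empty => simp [Ex_empty]
  | insert a K ha ih =>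
    rw [map_insert, Ex_insert (by simpa using ha), Ex_insert ha, ih, ih]
    simp only [map_insert]

section
variable {α : Type*} [DecidableEq α]

def emb (c : Bool) : α ↪ Bool × α := ⟨fun e => (c, e), fun _ _ h => (Prod.ext_iff.1 h).2⟩

lemma emb_apply (c : Bool) (e : α) : emb c e = (c, e) := rfl

def pB (p1 p2 : ℝ) : Bool × α → ℝ := fun b => bif b.1 then p1 else p2

def KB (K : Finset α) : Finset (Bool × α) := K.map (emb true) ∪ K.map (emb false)

lemma mem_KB {K : Finset α} {b : Bool × α} : b ∈ KB K ↔ b.2 ∈ K := by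
  obtain ⟨c, e⟩ := b
  cases c <;> simp [KB, emb_apply]

def layer (K : Finset α) (c : Bool) (E : Finset (Bool × α)) : Finset α :=
  K.filter fun e => (c, e) ∈ E

lemma probDouble_eq_s1 (K : Finset α) (p1 p2 : ℝ) (A : Finset α → Finset α → Prop) :
    probDouble K p1 p2 A =
      Ex (pB p1 p2) (KB K) (fun E => ind (A (layer K true E) (layer K false E))) := by
  unfold KB
  rw [Ex_union, Ex_map]
  · simp_rw [Ex_map]
    unfold probDouble Ex
    refine sum_congr rfl fun E1 hE1 => ?_
    rw [mul_sum]
    refine sum_congr rfl fun E2 hE2 => ?_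
    rw [mem_powerset] at hE1 hE2
    have h1 : layer K true (E1.map (emb true) ∪ E2.map (emb false)) = E1 := by
      ext a
      have := @hE1 a
      simp [layer, emb_apply]; try tauto
    have h2 : layer K false (E1.map (emb true) ∪ E2.map (emb false)) = E2 := by
      ext a
      have := @hE2 a
      simp [layer, emb_apply]; try tauto
    beta_reduce
    rw [h1, h2]
    simp only [pB, emb_apply, cond_true, cond_false, prod_const,
      card_sdiff_of_subset hE1, card_sdiff_of_subset hE2, ind]
    split_ifs <;> ring
  · rw [disjoint_left]
    rintro ⟨c, e⟩ h1 h2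
    simp only [Finset.mem_map, emb_apply, Prod.mk.injEq] at h1 h2
    obtain ⟨_, _, g1, _⟩ := h1
    obtain ⟨_, _, g2, _⟩ := h2
    have := g1.trans g2.symm
    simp at this
end

section
variable {V : Type} [DecidableEq V] [Fintype V]

def Good (K : Finset (Finset V)) (A : Finset V) (x y : V) (E : Finset (Bool × Finset V)) : Prop :=
  ∃ G : Finset (Bool × Sym2 V), Compat A (layer K true E) (layer K false E) G ∧
        ∃ X, Conn G X ∧ ({x, y} : Finset V) ⊆ X ∧ ∀ u ∈ X, u ∉ A

def lab (W : Finset V) : Finset (Bool × Sym2 V) :=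
  univ.filter fun l => ¬ l.2.IsDiag ∧ ∀ u ∈ l.2, u ∈ W

def blk (k : ℕ) (A W : Finset V) (l : Bool × Sym2 V) : Finset (Bool × Finset V) :=
  (KB ((univ : Finset V).powersetCard k)).filter fun b =>
    b.1 = l.1 ∧ A ⊆ b.2 ∧ b.2 ∩ W = l.2.toFinset

lemma blk_disj (k : ℕ) (A W : Finset V) (l l' : Bool × Sym2 V) (h : l ≠ l') :
    Disjoint (blk k A W l) (blk k A W l') := by
  rw [disjoint_left]
  intro b hb hb'
  simp only [blk, mem_filter] at hb hb'
  apply h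
  refine Prod.ext (hb.2.1.symm.trans hb'.2.1) (Sym2.ext fun a => ?_)
  rw [← Sym2.mem_toFinset, ← Sym2.mem_toFinset, ← hb.2.2.2, ← hb'.2.2.2]

lemma blk_card {k j : ℕ} (hj : 1 ≤ j) (hjk : j + 1 ≤ k) {A W : Finset V} (hA : A.card = j - 1)
    (hAW : Disjoint A W) {l : Bool × Sym2 V} (hl : l ∈ lab W) :
    ((A ∪ W)ᶜ.card).choose (k - j - 1) ≤ (blk k A W l).card := by
  rw [← card_powersetCard]
  obtain ⟨c, z⟩ := l
  simp only [lab, mem_filter, mem_univ, true_and] at hl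
  have hzW : z.toFinset ⊆ W := fun u hu => hl.2 u (Sym2.mem_toFinset.1 hu)
  have hU : ∀ Y ∈ powersetCard (k - j - 1) (A ∪ W)ᶜ, ∀ a ∈ Y, a ∉ A ∧ a ∉ W := by
    intro Y hY a ha
    have := (mem_powersetCard.1 hY).1 ha
    simpa [not_or] using this
  have hAW' : ∀ a, a ∈ A → a ∉ W := fun a ha => disjoint_left.1 hAW ha
  refine card_le_card_of_injOn (fun Y => (c, (A ∪ z.toFinset) ∪ Y)) ?_ ?_
  · intro Y hY
    rw [mem_coe] at hY
    have h1 := hU Y hY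
    have h2 := (mem_powersetCard.1 hY).2
    have hcard : ((A ∪ z.toFinset) ∪ Y).card = k := by
      rw [card_union_of_disjoint, card_union_of_disjoint, hA, h2,
        Sym2.card_toFinset_of_not_isDiag _ hl.1]
      · omega
      · exact disjoint_of_subset_right hzW hAW
      · rw [disjoint_left]
        intro a ha haY
        have := h1 a haY
        rcases mem_union.1 ha with ha | ha
        · exact this.1 ha
        · exact this.2 (hzW ha)
    simp only [blk, mem_coe, mem_filter, mem_KB, mem_powersetCard, subset_univ, true_and]
    refine ⟨hcard, subset_union_left.trans subset_union_left, ?_⟩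
    ext a
    have a1 := h1 a
    have a2 := @hzW a
    have a3 := hAW' a
    simp only [mem_inter, mem_union]
    tauto
  · intro Y hY Y' hY' h
    rw [mem_coe] at hY hY'
    have h := (Prod.ext_iff.1 h).2
    simp only at h
    ext a
    have a1 := hU Y hY a
    have a2 := hU Y' hY' a
    have a4 := @hzW a
    have a3 := Finset.ext_iff.1 h a
    simp only [mem_union] at a3
    tauto

lemma good_le {k j : ℕ} (hj : 1 ≤ j) (hjk : j + 1 ≤ k) {A W : Finset V} (hA : A.card = j - 1)
    (hAW : Disjoint A W) {x y : V} (hx : x ∈ W) (p1 p2 : ℝ)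
    (hp : ∀ b : Bool × Finset V, 0 ≤ pB p1 p2 b ∧ pB p1 p2 b ≤ 1) :
    ∃ q : Bool × Sym2 V → ℝ, (∀ e, 0 ≤ q e ∧ q e ≤ 1) ∧
      (∀ b ∈ lab W, 1 - q b ≤ Real.exp (-((bif b.1 then p1 else p2) *
        (((A ∪ W)ᶜ.card).choose (k - j - 1) : ℕ)))) ∧
      Ex (pB p1 p2) (KB ((univ : Finset V).powersetCard k))
        (fun E => ind (¬ Good ((univ : Finset V).powersetCard k) A x y E)) ≤
        Bad {x, y} q (lab W) ∅ := by
  refine ⟨fun l => Ex (pB p1 p2) (blk k A W l) (fun E => ind (E.Nonempty)), ?_, ?_, ?_⟩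
  · intro e
    refine ⟨Ex_nonneg hp fun _ _ => ind_nonneg _, ?_⟩
    have := Ex_mono (p := pB p1 p2) (K := blk k A W e) hp (f := fun E => ind (E.Nonempty))
      (g := fun _ => 1) (fun E _ => ind_le_one _)
    rwa [Ex_const] at this
  · intro l hl
    have h1 : 1 - Ex (pB p1 p2) (blk k A W l) (fun E => ind (E.Nonempty)) =
        ∏ e ∈ blk k A W l, (1 - pB p1 p2 e) := by
      rw [← Ex_none]
      have h2 := Ex_add (p := pB p1 p2) (blk k A W l) (fun E => ind (E.Nonempty))
        (fun E => ind (E = ∅))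
      have h3 : Ex (pB p1 p2) (blk k A W l) (fun E => ind (E.Nonempty) + ind (E = ∅)) = 1 := by
        rw [← Ex_const (p := pB p1 p2) (blk k A W l) 1]
        refine Ex_congr fun E _ => ?_
        rcases E.eq_empty_or_nonempty with rfl | hE
        · simp [ind]
        · simp [ind, hE, hE.ne_empty]
      linarith
    rw [h1]
    refine (prod_le_exp (r := bif l.1 then p1 else p2) hp ?_).trans ?_
    · intro e he
      simp only [blk, mem_filter] at he
      simp only [pB, he.2.1]
      linarith [Real.add_one_le_exp (-(bif l.1 then p1 else p2))]
    · apply Real.exp_le_exp.2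
      have h2 : ((((A ∪ W)ᶜ.card).choose (k - j - 1) : ℕ) : ℝ) ≤ (blk k A W l).card := by
        exact_mod_cast blk_card hj hjk hA hAW hl
      have h3 : 0 ≤ (bif l.1 then p1 else p2) := (hp (l.1, ∅)).1
      have := mul_le_mul_of_nonneg_left h2 h3
      linarith
  · set K' := KB ((univ : Finset V).powersetCard k)
    set S := blk k A W
    unfold Bad
    have hsub : (lab W).biUnion S ⊆ K' := by
      rw [biUnion_subset]; intro l _; exact filter_subset _ _
    rw [← Ex_push (p := pB p1 p2) (lab W) S (fun l _ l' _ h => blk_disj k A W l l' h)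
      (fun _ E => E.Nonempty) (fun E => ind (¬ Tgt {x, y} (∅ ∪ E))),
      ← Ex_marginal hsub]
    refine Ex_mono hp fun E hE => ind_mono fun hng ht => hng ?_
    obtain ⟨X, hX, hxy⟩ := ht
    rw [empty_union] at hX
    refine ⟨_, ?_, X, hX, hxy, ?_⟩
    · intro c u w huw
      simp only [mem_filter] at huw
      obtain ⟨hl, ⟨b, hb⟩⟩ := huw
      rw [mem_inter, mem_inter] at hb
      obtain ⟨⟨hbE, -⟩, hbS⟩ := hb
      simp only [S, blk, mem_filter] at hbS
      obtain ⟨hbK, hbc, hAb, hbW⟩ := hbS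
      have hmem : b.2 ∈ layer ((univ : Finset V).powersetCard k) c E := by
        simp only [layer, mem_filter]
        refine ⟨mem_KB.1 hbK, ?_⟩
        rw [← hbc]; exact hbE
      refine ⟨b.2, ?_, ?_⟩
      · cases c <;> exact hmem
      · have hu : u ∈ b.2 := by
          have : u ∈ b.2 ∩ W := by rw [hbW]; simp
          exact (mem_inter.1 this).1
        have hw : w ∈ b.2 := by
          have : w ∈ b.2 ∩ W := by rw [hbW]; simp
          exact (mem_inter.1 this).1
        exact union_subset (insert_subset hu hAb) (insert_subset hw hAb)
    · refine conn_avoid ?_ hX ⟨x, hxy (by simp), disjoint_right.1 hAW hx⟩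
      intro c u w huw
      have huw := (mem_filter.1 huw).1
      rw [lab, mem_filter] at huw
      exact ⟨disjoint_right.1 hAW (huw.2.2 u (by simp)), disjoint_right.1 hAW (huw.2.2 w (by simp))⟩
end


lemma num1 {n κ c1 L p Mc : ℝ} {t : ℕ} (hn : 0 < n) (hκ : 0 < κ) (hκ1 : κ ≤ 1) (hc1 : 0 < c1)
    (hL : 0 < L) (hp : c1 / κ ^ 2 * L / n ^ (t + 1) ≤ p) (hM : κ * n ^ t ≤ Mc) :
    c1 * L / n ≤ p * Mc := by
  have h1 : c1 / κ ^ 2 * L / n ^ (t + 1) * (κ * n ^ t) ≤ p * Mc :=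
    mul_le_mul hp hM (by positivity) (le_trans (by positivity) hp)
  have h2 : c1 / κ ^ 2 * L / n ^ (t + 1) * (κ * n ^ t) = (c1 * L / n) / κ := by
    rw [pow_succ n t]
    field_simp
  have h3 : c1 * L / n ≤ (c1 * L / n) / κ := le_div_self (by positivity) hκ hκ1
  linarith

lemma num2 {n κ c1 L p p' Mc : ℝ} {t : ℕ} (hn : 0 < n) (hκ : 0 < κ) (hc1 : 0 < c1)
    (hL : 0 < L) (hp : c1 / κ ^ 2 / (n ^ (2 * t + 1) * L) ≤ p * p') (hM : κ * n ^ t ≤ Mc) :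
    c1 / (n * L) ≤ p * Mc * (p' * Mc) := by
  have h0 : (κ * n ^ t) ^ 2 ≤ Mc ^ 2 := pow_le_pow_left₀ (by positivity) hM 2
  have h1 : c1 / κ ^ 2 / (n ^ (2 * t + 1) * L) * (κ * n ^ t) ^ 2 ≤ p * p' * Mc ^ 2 :=
    mul_le_mul hp h0 (by positivity) (le_trans (by positivity) hp)
  have h2 : c1 / κ ^ 2 / (n ^ (2 * t + 1) * L) * (κ * n ^ t) ^ 2 = c1 / (n * L) := by
    rw [pow_succ n (2 * t), pow_mul' n 2 t]
    field_simp
  calc _ = _ := h2.symm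
    _ ≤ _ := h1
    _ = _ := by ring

lemma choose_lb {n k j u t : ℕ} (ht : t = k - j - 1) (hjk : j + 1 ≤ k) (hj : 1 ≤ j) (hn : 4 * k ≤ n)
    (hu : u + (j - 1) + n / 2 = n) :
    1 / (4 ^ t * (t.factorial : ℝ)) * (n:ℝ) ^ t ≤ (u.choose t : ℝ) := by
  refine le_trans ?_ (Nat.pow_le_choose (α := ℝ) t u)
  have h1 : (n:ℝ) / 4 ≤ ((u + 1 - t : ℕ) : ℝ) := by
    rw [div_le_iff₀ (by norm_num)]
    have : n ≤ (u + 1 - t) * 4 := by omega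
    exact_mod_cast this
  have h2 : 1 / (4 ^ t * (t.factorial : ℝ)) * (n:ℝ) ^ t = ((n:ℝ) / 4) ^ t / t.factorial := by
    rw [div_pow]; field_simp
  rw [h2]
  gcongr

lemma main_bound {k j : ℕ} (hj : 1 ≤ j) (hjk : j + 1 ≤ k) {c1 M : ℝ} (hc1 : 1 ≤ c1)
    (hg : ∀ (n : ℕ) (y : ℝ), (n : ℝ) = Real.exp y →
    24 ≤ y → M * y ≤ Real.exp (y / 4) →
    ∀ (V : Type) [DecidableEq V] (Z R : Finset V) (K : Finset (Bool × Sym2 V))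
      (q : Bool × Sym2 V → ℝ) (r : Bool → ℝ),
      (∀ e, 0 ≤ q e ∧ q e ≤ 1) → (∀ c, c1 * y / n ≤ r c) → c1 / (n * y) ≤ r true * r false →
      (∀ b ∈ K, 1 - q b ≤ Real.exp (-r b.1)) → Fr Z K R → Disjoint R Z → Z.card ≤ 2 →
      (n : ℝ) / 3 - 2 ≤ R.card → Bad Z q K ∅ ≤ 1 / (n : ℝ) ^ (j + 2))
    {n : ℕ} (hn : 4 * k ≤ n) (hlog : 24 ≤ Real.log n) (hM : M * Real.log n ≤ Real.exp (Real.log n / 4))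
    {κ : ℝ} (hκ : κ = 1 / (4 ^ (k - j - 1) * ((k - j - 1).factorial : ℝ)))
    {p1 p2 : ℝ} (hp1 : 0 ≤ p1 ∧ p1 ≤ 1) (hp2 : 0 ≤ p2 ∧ p2 ≤ 1)
    (h1 : c1 / κ ^ 2 / ((n : ℝ) ^ (2 * k - 2 * j - 1) * Real.log n) ≤ p1 * p2)
    (h2 : c1 / κ ^ 2 * Real.log n / (n : ℝ) ^ (k - j) ≤ min p1 p2)
    {A : Finset (Fin n)} (hA : A.card = j - 1) {x y : Fin n} (hx : x ∉ A) (hy : y ∉ A)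
    (hxy : x ≠ y) :
    Ex (pB p1 p2) (KB ((univ : Finset (Fin n)).powersetCard k))
        (fun E => ind (¬ Good ((univ : Finset (Fin n)).powersetCard k) A x y E)) ≤
      1 / (n:ℝ) ^ (j + 2) := by
  have hp : ∀ b : Bool × Finset (Fin n), 0 ≤ pB p1 p2 b ∧ pB p1 p2 b ≤ 1 := by
    rintro ⟨c, e⟩; cases c
    · exact hp2
    · exact hp1
  have hAc : Aᶜ.card = n - (j - 1) := by rw [card_compl, hA, Fintype.card_fin]
  obtain ⟨W, hW1, hW2, hW3⟩ := exists_subsuperset_card_eq (s := {x, y}) (t := Aᶜ) (n := n / 2)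
    (by intro a ha; simp only [mem_insert, mem_singleton] at ha; rcases ha with rfl | rfl <;> simpa)
    (by rw [card_pair hxy]; omega) (by rw [hAc]; omega)
  have hAW : Disjoint A W := by
    rw [disjoint_right]; intro a ha; simpa using hW2 ha
  have hxW : x ∈ W := hW1 (by simp)
  have hyW : y ∈ W := hW1 (by simp)
  obtain ⟨q, hq, hq1, hq2⟩ := good_le hj hjk hA hAW (y := y) hxW p1 p2 hp
  refine hq2.trans ?_
  have hn0 : (0:ℝ) < n := by
    have : 0 < n := by omega
    exact_mod_cast this
  have hu : (A ∪ W)ᶜ.card + (j - 1) + n / 2 = n := by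
    have := card_compl_add_card (A ∪ W)
    rw [card_union_of_disjoint hAW, hA, hW3, Fintype.card_fin] at this
    omega
  have hMc := choose_lb (t := k - j - 1) rfl hjk hj hn hu
  rw [← hκ] at hMc
  set Mc : ℝ := (((A ∪ W)ᶜ.card.choose (k - j - 1) : ℕ) : ℝ)
  have hκ0 : 0 < κ := by rw [hκ]; positivity
  have hκ1 : κ ≤ 1 := by
    rw [hκ, div_le_one (by positivity)]
    have a1 : (1:ℝ) ≤ 4 ^ (k - j - 1) := one_le_pow₀ (by norm_num)
    have a2 : (1:ℝ) ≤ ((k - j - 1).factorial : ℝ) := by exact_mod_cast Nat.factorial_pos _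
    exact one_le_mul_of_one_le_of_one_le a1 a2
  rw [show k - j = (k - j - 1) + 1 by omega] at h2
  rw [show 2 * k - 2 * j - 1 = 2 * (k - j - 1) + 1 by omega] at h1
  have hL : 0 < Real.log n := by linarith
  refine hg n (Real.log n) (Real.exp_log hn0).symm hlog hM (Fin n) {x, y} (W \ {x, y}) (lab W) q
    (fun c => (bif c then p1 else p2) * Mc) hq ?_ ?_ hq1 ?_ sdiff_disjoint (card_pair hxy).le ?_
  · intro c
    refine num1 hn0 hκ0 hκ1 (by linarith) hL (h2.trans ?_) hMc
    cases c
    · exact min_le_right _ _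
    · exact min_le_left _ _
  · exact num2 hn0 hκ0 (by linarith) hL h1 hMc
  · intro c u hu v hv huv
    simp only [lab, mem_filter, mem_univ, true_and, Sym2.mk_isDiag_iff, Sym2.mem_iff]
    refine ⟨huv, ?_⟩
    have hvW : v ∈ W := by
      rcases mem_union.1 hv with hv | hv
      · exact (Finset.mem_sdiff.1 hv).1
      · exact hW1 hv
    rintro a (rfl | rfl)
    · exact (Finset.mem_sdiff.1 hu).1
    · exact hvW
  · rw [card_sdiff_of_subset hW1, card_pair hxy, hW3]
    have h6 : n ≤ 3 * (n / 2 - 2 + 2) := by omega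
    have h7 : (n:ℝ) ≤ 3 * (((n / 2 - 2 : ℕ) : ℝ) + 2) := by exact_mod_cast h6
    linarith

lemma fail_bound {k j : ℕ} (hj : 1 ≤ j) {n : ℕ} (hn : j ≤ n) (hn0 : 0 < n)
    {p1 p2 : ℝ} (hp1 : 0 ≤ p1 ∧ p1 ≤ 1) (hp2 : 0 ≤ p2 ∧ p2 ≤ 1)
    (h : ∀ A : Finset (Fin n), A.card = j - 1 → ∀ x y, x ∉ A → y ∉ A → x ≠ y →
      Ex (pB p1 p2) (KB ((univ : Finset (Fin n)).powersetCard k))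
        (fun E => ind (¬ Good ((univ : Finset (Fin n)).powersetCard k) A x y E)) ≤
      1 / (n:ℝ) ^ (j + 2)) :
    1 - 1 / (n:ℝ) ≤ probHk n k p1 p2 (fun E1 E2 => JPercolates j E1 E2) ∧
      probHk n k p1 p2 (fun E1 E2 => JPercolates j E1 E2) ≤ 1 := by
  have hp : ∀ b : Bool × Finset (Fin n), 0 ≤ pB p1 p2 b ∧ pB p1 p2 b ≤ 1 := by
    rintro ⟨c, e⟩; cases c
    · exact hp2
    · exact hp1
  unfold probHk
  rw [probDouble_eq_s1]
  set K := (univ : Finset (Fin n)).powersetCard k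
  set T := (((univ : Finset (Fin n)).powersetCard (j - 1)) ×ˢ
    ((univ : Finset (Fin n)) ×ˢ (univ : Finset (Fin n)))).filter
      (fun t => t.2.1 ∉ t.1 ∧ t.2.2 ∉ t.1 ∧ t.2.1 ≠ t.2.2) with hT
  constructor
  · have hle : Ex (pB p1 p2) (KB K) (fun _ => 1) ≤ Ex (pB p1 p2) (KB K)
        (fun E => ind (JPercolates j (layer K true E) (layer K false E)) +
          ∑ t ∈ T, ind (¬ Good K t.1 t.2.1 t.2.2 E)) := by
      refine Ex_mono hp fun E _ => ?_
      by_cases hP : JPercolates j (layer K true E) (layer K false E)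
      · rw [ind_true hP]
        have : 0 ≤ ∑ t ∈ T, ind (¬ Good K t.1 t.2.1 t.2.2 E) := sum_nonneg fun _ _ => ind_nonneg _
        linarith
      · rw [ind_false hP, zero_add]
        obtain ⟨t, ht, htg⟩ : ∃ t ∈ T, ¬ Good K t.1 t.2.1 t.2.2 E := by
          by_contra hcon
          push Not at hcon
          apply hP
          refine jperc_of hj (by simpa using hn) fun A hA x y hx hy hxy => ?_
          exact hcon (A, x, y) (by simp [hT, hA, hx, hy, hxy])
        have := single_le_sum (f := fun t => ind (¬ Good K t.1 t.2.1 t.2.2 E))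
          (fun _ _ => ind_nonneg _) ht
        simp only [ind_true htg] at this
        exact this
    rw [Ex_const, Ex_add, Ex_sum] at hle
    have hsum : ∑ t ∈ T, Ex (pB p1 p2) (KB K) (fun E => ind (¬ Good K t.1 t.2.1 t.2.2 E)) ≤
        1 / (n:ℝ) := by
      have hn' : (0:ℝ) < n := by exact_mod_cast hn0
      have hTc : (T.card : ℝ) ≤ (n:ℝ) ^ (j + 1) := by
        have : T.card ≤ n ^ (j + 1) := by
          refine (card_filter_le _ _).trans ?_
          rw [card_product, card_product, card_powersetCard, card_univ, Fintype.card_fin]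
          calc n.choose (j - 1) * (n * n) ≤ n ^ (j - 1) * (n * n) :=
                Nat.mul_le_mul_right _ (Nat.choose_le_pow _ _)
            _ = n ^ (j - 1 + 2) := by ring
            _ = n ^ (j + 1) := by congr 1; omega
        exact_mod_cast this
      calc _ ≤ ∑ t ∈ T, 1 / (n:ℝ) ^ (j + 2) := by
            refine sum_le_sum fun t ht => ?_
            simp only [hT, mem_filter, mem_product, mem_powersetCard] at ht
            exact h _ ht.1.1.2 _ _ ht.2.1 ht.2.2.1 ht.2.2.2
        _ = T.card * (1 / (n:ℝ) ^ (j + 2)) := by rw [sum_const, nsmul_eq_mul]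
        _ ≤ (n:ℝ) ^ (j + 1) * (1 / (n:ℝ) ^ (j + 2)) :=
            mul_le_mul_of_nonneg_right hTc (by positivity)
        _ = 1 / n := by rw [pow_succ (n:ℝ) (j + 1)]; field_simp
    linarith
  · have := Ex_mono (p := pB p1 p2) (K := KB K) hp
      (f := fun E => ind (JPercolates j (layer K true E) (layer K false E)))
      (g := fun _ => 1) (fun E _ => ind_le_one _)
    rwa [Ex_const] at this

theorem jigsaw_hypergraph_supercritical (k j : ℕ) (hj : 1 ≤ j) (hjk : j ≤ k - 1) :
    ∃ c : ℝ, 0 < c ∧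
      ∀ p1 p2 : ℕ → ℝ,
        (∀ n, 0 ≤ p1 n ∧ p1 n ≤ 1) →
        (∀ n, 0 ≤ p2 n ∧ p2 n ≤ 1) →
        (∀ᶠ n : ℕ in atTop,
          c / ((n : ℝ) ^ (2 * k - 2 * j - 1) * Real.log n) ≤ p1 n * p2 n ∧
          c * Real.log n / (n : ℝ) ^ (k - j) ≤ min (p1 n) (p2 n)) →
        Tendsto
          (fun n : ℕ => probHk n k (p1 n) (p2 n) fun E1 E2 => JPercolates j E1 E2)
          atTop (nhds 1) := by
  have hjk' : j + 1 ≤ k := by omega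
  obtain ⟨c1, hc1, M, hg⟩ := graph_num (j + 2)
  obtain ⟨κ, hκ⟩ : ∃ κ : ℝ, κ = 1 / (4 ^ (k - j - 1) * ((k - j - 1).factorial : ℝ)) := ⟨_, rfl⟩
  have hκ0 : 0 < κ := by rw [hκ]; positivity
  have hc10 : 0 < c1 := by linarith
  refine ⟨c1 / κ ^ 2, by positivity, ?_⟩
  intro p1 p2 hp1 hp2 hev
  have hlog : Tendsto (fun n : ℕ => Real.log n) atTop atTop :=
    Real.tendsto_log_atTop.comp tendsto_natCast_atTop_atTop
  have hb : ∀ᶠ n : ℕ in atTop,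
      1 - 1 / (n:ℝ) ≤ probHk n k (p1 n) (p2 n) (fun E1 E2 => JPercolates j E1 E2) ∧
      probHk n k (p1 n) (p2 n) (fun E1 E2 => JPercolates j E1 E2) ≤ 1 := by
    filter_upwards [hev, hlog.eventually_ge_atTop 24, hlog.eventually_ge_atTop (32 * M),
      eventually_ge_atTop (4 * k)] with n h12 hl24 hlM hn
    refine fail_bound hj (by omega) (by omega) (hp1 n) (hp2 n) ?_
    intro A hA x y hx hy hxy
    refine main_bound hj hjk' hc1 hg hn hl24 ?_ hκ (hp1 n) (hp2 n) h12.1 h12.2 hA hx hy hxy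
    set L := Real.log n
    have h1 := Real.quadratic_le_exp_of_nonneg (x := L / 4) (by linarith)
    have h2 : 32 * M * L ≤ L * L := mul_le_mul_of_nonneg_right hlM (by linarith)
    nlinarith
  have hlim : Tendsto (fun n : ℕ => 1 - 1 / (n:ℝ)) atTop (nhds 1) := by
    simpa using tendsto_const_nhds.sub (tendsto_one_div_atTop_nhds_zero_nat (𝕜 := ℝ))
  exact tendsto_of_tendsto_of_tendsto_of_le_of_le' hlim tendsto_const_nhds
    (hb.mono fun _ h => h.1) (hb.mono fun _ h => h.2)
end
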